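/- arXiv:2110.06988 — 4 statements merged into one kernel-verified Lean document; each statement's English description precedes it below -/
import Mathlib

section
/- Assume the symmetrized kernel k̂_ε is positive semidefinite (for every finite collection of points of M, the matrix (k̂_ε(x_i,x_j))_{ij} is positive semidefinite). Define λ_i^ε := (2/(m₂ ε))(1 − σ_i(K̂_ε)), where σ_i(K̂_ε) := sup over i-dimensional subspaces S of L²(V) of inf_{f ∈ S, ‖f‖=1} ⟨K̂_ε f, f⟩ is the i-th Courant–Fischer value of K̂_ε, and let λ_i^{ε,n} := (2/(m₂ ε))(1 − σ_i^n), where σ_1^n ≥ … ≥ σ_n^n are the eigenvalues of the n×n symmetric matrix with entries (1/n) k̂_ε(x_i,x_j). Then, with probability at least 1 − 2/n² over the i.i.d. sample x₁,…,xₙ drawn from V, one has sup_{1≤i≤n} |λ_i^ε − λ_i^{ε,n}| ≤ 4√2 · √(2 log n) / (m₂ ε^{d/2+1} √n · d_min). -/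
open MeasureTheory Real

/-- The `i`-th Courant–Fischer (sup-inf) value of a quadratic form `Q`:
the supremum over `i`-dimensional subspaces `S` of the infimum of `Q` over
unit vectors of `S`. -/
noncomputable def cfSup {H : Type*} [NormedAddCommGroup H] [Module ℝ H]
    (Q : H → ℝ) (i : ℕ) : ℝ :=
  ⨆ S : {S : Submodule ℝ H // Module.finrank ℝ ↥S = i},
    ⨅ f : {f : H // f ∈ S.1 ∧ ‖f‖ = 1}, Q f.1

open scoped TensorProduct

lemma hasSum_cosh_mul_sqrt (l : ℝ) {s : ℝ} (hs : 0 ≤ s) :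
    HasSum (fun k : ℕ => l ^ (2 * k) / ((2 * k).factorial : ℝ) * s ^ k) (cosh (l * √s)) := by
  convert! Real.hasSum_cosh (l * √s) using 2 with k
  rw [mul_pow, pow_mul √s, Real.sq_sqrt hs]
  ring

lemma convexOn_cosh_mul_sqrt (l : ℝ) :
    ConvexOn ℝ (Set.Ici 0) fun s : ℝ => cosh (l * √s) := by
  refine ⟨convex_Ici 0, fun s hs t ht a b ha hb hab => ?_⟩
  have hst : 0 ≤ a • s + b • t := (convex_Ici (0 : ℝ)) hs ht ha hb hab
  refine hasSum_le (fun k => ?_) (hasSum_cosh_mul_sqrt l hst)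
    (((hasSum_cosh_mul_sqrt l hs).mul_left a).add ((hasSum_cosh_mul_sqrt l ht).mul_left b))
  have h := (convexOn_pow k).2 hs ht ha hb hab
  have h0 : 0 ≤ l ^ (2 * k) / ((2 * k).factorial : ℝ) := by
    rw [pow_mul]; positivity
  have := mul_le_mul_of_nonneg_left h h0
  simp only [smul_eq_mul] at this ⊢
  linarith

/-- One step of Pinelis' argument: up to a term linear in `ξ`, adding a vector of norm at most `R`
increases `cosh (l * ‖x‖)` by at most the factor `cosh (l * R)`. -/
lemma exists_cosh_norm_add_le {G : Type*} [NormedAddCommGroup G] [InnerProductSpace ℝ G]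
    {l R : ℝ} (hl : 0 ≤ l) (x : G) :
    ∃ c : ℝ, ∀ ξ : G, ‖ξ‖ ≤ R →
      cosh (l * ‖x + ξ‖) ≤ cosh (l * ‖x‖) * cosh (l * R) + c * inner ℝ x ξ := by
  rcases eq_or_ne x 0 with rfl | hx
  · refine ⟨0, fun ξ hξ => ?_⟩
    have : cosh (l * ‖ξ‖) ≤ cosh (l * R) := by
      rw [Real.cosh_le_cosh, abs_of_nonneg (by positivity), abs_of_nonneg]
      · gcongr
      · exact mul_nonneg hl ((norm_nonneg _).trans hξ)
    simpa using this
  rcases le_or_gt R 0 with hR | hR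
  · refine ⟨0, fun ξ hξ => ?_⟩
    have h0 : ‖ξ‖ = 0 := le_antisymm (hξ.trans hR) (norm_nonneg _)
    have hR0 : R = 0 := le_antisymm hR (h0 ▸ hξ)
    simp [norm_eq_zero.1 h0, hR0]
  have ha : 0 < ‖x‖ := norm_pos_iff.2 hx
  set a := ‖x‖ with ha_def
  refine ⟨sinh (l * a) * sinh (l * R) / (a * R), fun ξ hξ => ?_⟩
  set u := inner ℝ x ξ with hu
  have hub : |u| ≤ a * R := (abs_real_inner_le_norm x ξ).trans (by gcongr)
  obtain ⟨hu1, hu2⟩ := abs_le.1 hub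
  have haR : 0 < a * R := by positivity
  set p := (1 + u / (a * R)) / 2 with hp
  set q := (1 - u / (a * R)) / 2 with hq
  have hdiv1 : -1 ≤ u / (a * R) := by rw [le_div_iff₀ haR]; linarith
  have hdiv2 : u / (a * R) ≤ 1 := by rw [div_le_iff₀ haR]; linarith
  have hmul : u / (a * R) * (a * R) = u := div_mul_cancel₀ _ haR.ne'
  have hconv := (convexOn_cosh_mul_sqrt l).2 (Set.mem_Ici.2 (sq_nonneg (a + R)))
    (Set.mem_Ici.2 (sq_nonneg (a - R))) (show 0 ≤ p by linarith) (show 0 ≤ q by linarith)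
    (by rw [hp, hq]; ring)
  have hpt : p • (a + R) ^ 2 + q • (a - R) ^ 2 = a ^ 2 + R ^ 2 + 2 * u := by
    simp only [smul_eq_mul, hp, hq]
    linear_combination 2 * hmul
  have hval1 : cosh (l * √((a + R) ^ 2)) =
      cosh (l * a) * cosh (l * R) + sinh (l * a) * sinh (l * R) := by
    rw [Real.sqrt_sq (by positivity), mul_add, Real.cosh_add]
  have hval2 : cosh (l * √((a - R) ^ 2)) =
      cosh (l * a) * cosh (l * R) - sinh (l * a) * sinh (l * R) := by
    rw [Real.sqrt_sq_eq_abs, ← abs_of_nonneg hl, ← abs_mul, Real.cosh_abs, abs_of_nonneg hl, mul_sub,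
      Real.cosh_sub]
  have hle : cosh (l * ‖x + ξ‖) ≤ cosh (l * √(a ^ 2 + R ^ 2 + 2 * u)) := by
    rw [Real.cosh_le_cosh, abs_of_nonneg (by positivity), abs_of_nonneg (by positivity)]
    refine mul_le_mul_of_nonneg_left (Real.le_sqrt_of_sq_le ?_) hl
    rw [norm_add_sq_real]
    nlinarith [norm_nonneg ξ]
  rw [hpt] at hconv
  beta_reduce at hconv
  rw [hval1, hval2] at hconv
  refine (hle.trans hconv).trans (le_of_eq ?_)
  simp only [smul_eq_mul, hp, hq]
  ring

lemma integral_cosh_norm_add_sum_le {X G : Type*} [TopologicalSpace X] [CompactSpace X]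
    [SecondCountableTopology X] [MeasurableSpace X] [BorelSpace X]
    [NormedAddCommGroup G] [InnerProductSpace ℝ G] [CompleteSpace G]
    (V : Measure X) [IsProbabilityMeasure V] {ξ : X → G} (hξ : Continuous ξ)
    (hmean : ∫ x, ξ x ∂V = 0) {l R : ℝ} (hl : 0 ≤ l) (hR : ∀ x, ‖ξ x‖ ≤ R) (n : ℕ) (x : G) :
    ∫ ω : Fin n → X, cosh (l * ‖x + ∑ a, ξ (ω a)‖) ∂(Measure.pi fun _ => V) ≤
      cosh (l * ‖x‖) * cosh (l * R) ^ n := by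
  have integrable_of_cont : ∀ {Y : Type _} [TopologicalSpace Y] [CompactSpace Y] [MeasurableSpace Y]
      [OpensMeasurableSpace Y] (μ : Measure Y) [IsFiniteMeasure μ] (f : Y → ℝ), Continuous f →
      Integrable f μ := fun μ _ f hf =>
    hf.integrable_of_hasCompactSupport (HasCompactSupport.of_compactSpace f)
  induction n generalizing x with
  | zero => simp
  | succ n ih =>
    have hmp := measurePreserving_piFinSuccAbove (fun _ : Fin (n + 1) => V) 0
    have heq : ∫ ω : Fin (n + 1) → X, cosh (l * ‖x + ∑ a, ξ (ω a)‖) ∂(Measure.pi fun _ => V) =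
        ∫ p : X × (Fin n → X), cosh (l * ‖(x + ξ p.1) + ∑ a, ξ (p.2 a)‖)
          ∂(V.prod (Measure.pi fun _ => V)) := by
      rw [← hmp.integral_comp']
      refine integral_congr_ae (ae_of_all _ fun ω => ?_)
      simp [Fin.sum_univ_succ, add_assoc, MeasurableEquiv.piFinSuccAbove, Fin.tail]
    rw [heq, integral_prod _ (integrable_of_cont _ _ (by fun_prop))]
    obtain ⟨c, hc⟩ := exists_cosh_norm_add_le (R := R) hl x
    have hξi : Integrable ξ V :=
      hξ.integrable_of_hasCompactSupport (HasCompactSupport.of_compactSpace ξ)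
    calc ∫ y, ∫ ω : Fin n → X, cosh (l * ‖(x + ξ y) + ∑ a, ξ (ω a)‖) ∂(Measure.pi fun _ => V) ∂V
        ≤ ∫ y, (cosh (l * ‖x‖) * cosh (l * R) + c * inner ℝ x (ξ y)) * cosh (l * R) ^ n ∂V := by
          refine integral_mono (integrable_of_cont _ (fun p : X × (Fin n → X) =>
            cosh (l * ‖(x + ξ p.1) + ∑ a, ξ (p.2 a)‖)) (by fun_prop)).integral_prod_left
            (integrable_of_cont _ _ (by fun_prop)) fun y => (ih (x + ξ y)).trans ?_
          exact mul_le_mul_of_nonneg_right (hc _ (hR y)) (pow_nonneg (Real.cosh_pos _).le _)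
      _ = cosh (l * ‖x‖) * cosh (l * R) ^ (n + 1) := by
          rw [integral_mul_const, integral_add (integrable_const _) ((hξi.const_inner x).const_mul c),
            integral_const_mul c, integral_inner hξi, hmean]
          simp [pow_succ]
          ring

/-- Pinelis' inequality for sums of i.i.d. bounded centered vectors in a Hilbert space. -/
lemma measure_le_norm_sum_le {X G : Type*} [TopologicalSpace X] [CompactSpace X]
    [SecondCountableTopology X] [MeasurableSpace X] [BorelSpace X]
    [NormedAddCommGroup G] [InnerProductSpace ℝ G] [CompleteSpace G]
    (V : Measure X) [IsProbabilityMeasure V] {ξ : X → G} (hξ : Continuous ξ)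
    (hmean : ∫ x, ξ x ∂V = 0) {R : ℝ} (hR0 : 0 < R) (hR : ∀ x, ‖ξ x‖ ≤ R) {n : ℕ} (hn : 0 < n)
    {s : ℝ} (hs : 0 ≤ s) :
    (Measure.pi fun _ : Fin n => V).real {ω | s ≤ ‖∑ a, ξ (ω a)‖} ≤
      2 * exp (-(s ^ 2 / (2 * n * R ^ 2))) := by
  have hn' : (0 : ℝ) < n := by exact_mod_cast hn
  set l := s / (n * R ^ 2) with hl_def
  have hl : 0 ≤ l := by positivity
  have hE := integral_cosh_norm_add_sum_le V hξ hmean hl hR n 0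
  have hcont : Continuous fun ω : Fin n → X => cosh (l * ‖∑ a, ξ (ω a)‖) := by fun_prop
  have hM := mul_meas_ge_le_integral_of_nonneg (μ := Measure.pi fun _ : Fin n => V)
    (f := fun ω : Fin n → X => cosh (l * ‖∑ a, ξ (ω a)‖))
    (ae_of_all _ fun ω => (Real.cosh_pos _).le)
    (hcont.integrable_of_hasCompactSupport (HasCompactSupport.of_compactSpace _)) (cosh (l * s))
  have hsub : (Measure.pi fun _ : Fin n => V).real {ω | s ≤ ‖∑ a, ξ (ω a)‖} ≤
      (Measure.pi fun _ : Fin n => V).real {ω | cosh (l * s) ≤ cosh (l * ‖∑ a, ξ (ω a)‖)} := by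
    refine measureReal_mono fun ω hω => ?_
    simp only [Set.mem_ofPred_eq] at hω ⊢
    rw [Real.cosh_le_cosh, abs_of_nonneg (by positivity), abs_of_nonneg (by positivity)]
    gcongr
  have hcosh : exp (l * s) / 2 ≤ cosh (l * s) := by
    rw [Real.cosh_eq]; linarith [exp_pos (-(l * s))]
  have hpow : cosh (l * R) ^ n ≤ exp (n * ((l * R) ^ 2 / 2)) := by
    rw [Real.exp_nat_mul]
    exact pow_le_pow_left₀ (Real.cosh_pos _).le (Real.cosh_le_exp_half_sq _) n
  simp only [zero_add, norm_zero, mul_zero, Real.cosh_zero, one_mul] at hE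
  have h1 := (mul_le_mul_of_nonneg_left hsub (Real.cosh_pos (l * s)).le).trans
    (hM.trans (hE.trans hpow))
  have h2 := (mul_le_mul_of_nonneg_right hcosh measureReal_nonneg).trans h1
  have h3 : (n * ((l * R) ^ 2 / 2) : ℝ) = -(s ^ 2 / (2 * n * R ^ 2)) + l * s := by
    rw [hl_def]; field_simp; ring
  rw [h3, exp_add] at h2
  have h4 := exp_pos (l * s)
  refine le_of_mul_le_mul_left ?_ h4
  linarith

section CourantFischer

variable {E E₁ E₂ H : Type*} [NormedAddCommGroup E] [InnerProductSpace ℝ E]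
  [NormedAddCommGroup E₁] [InnerProductSpace ℝ E₁]
  [NormedAddCommGroup E₂] [InnerProductSpace ℝ E₂]
  [NormedAddCommGroup H] [InnerProductSpace ℝ H]

lemma Submodule.exists_mem_norm_eq_one {S : Submodule ℝ E} {i : ℕ} (hi : 1 ≤ i)
    (hS : Module.finrank ℝ S = i) : ∃ f ∈ S, ‖f‖ = 1 := by
  have : Nontrivial S := Module.nontrivial_of_finrank_pos (R := ℝ) (by omega)
  obtain ⟨f, hf⟩ := exists_ne (0 : S)
  have hf' : (f : E) ≠ 0 := by simpa using hf
  exact ⟨‖(f : E)‖⁻¹ • (f : E), S.smul_mem _ f.2, norm_smul_inv_norm (𝕜 := ℝ) hf'⟩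

lemma le_cfSup_norm_sq (A : E →L[ℝ] H) {i : ℕ} (hi : 1 ≤ i) {S : Submodule ℝ E}
    (hS : Module.finrank ℝ S = i) {c : ℝ} (hc : ∀ f ∈ S, c * ‖f‖ ^ 2 ≤ ‖A f‖ ^ 2) :
    c ≤ cfSup (fun f => ‖A f‖ ^ 2) i := by
  have hbdd : BddAbove (Set.range fun S : {S : Submodule ℝ E // Module.finrank ℝ ↥S = i} =>
      ⨅ f : {f : E // f ∈ S.1 ∧ ‖f‖ = 1}, ‖A f.1‖ ^ 2) := by
    refine ⟨‖A‖ ^ 2, ?_⟩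
    rintro _ ⟨T, rfl⟩
    obtain ⟨f, hf, hf1⟩ := Submodule.exists_mem_norm_eq_one hi T.2
    refine (ciInf_le ⟨0, ?_⟩ ⟨f, hf, hf1⟩).trans ?_
    · rintro _ ⟨g, rfl⟩
      positivity
    · have := A.le_opNorm f
      rw [hf1, mul_one] at this
      exact pow_le_pow_left₀ (norm_nonneg _) this 2
  refine le_ciSup_of_le hbdd ⟨S, hS⟩ ?_
  obtain ⟨f, hf, hf1⟩ := Submodule.exists_mem_norm_eq_one hi hS
  have : Nonempty {f : E // f ∈ S ∧ ‖f‖ = 1} := ⟨⟨f, hf, hf1⟩⟩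
  refine le_ciInf fun g => ?_
  simpa [g.2.2] using hc g.1 g.2.1

lemma exists_of_lt_cfSup_norm_sq (A : E →L[ℝ] H) {i : ℕ} {c : ℝ} (hc0 : 0 ≤ c)
    (hc : c < cfSup (fun f => ‖A f‖ ^ 2) i) :
    ∃ S : Submodule ℝ E, Module.finrank ℝ S = i ∧ ∀ f ∈ S, c * ‖f‖ ^ 2 ≤ ‖A f‖ ^ 2 := by
  rcases isEmpty_or_nonempty {S : Submodule ℝ E // Module.finrank ℝ ↥S = i} with hemp | hne
  · rw [cfSup, Real.iSup_of_isEmpty] at hc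
    exact absurd hc hc0.not_gt
  obtain ⟨S, hS⟩ := exists_lt_of_lt_ciSup hc
  refine ⟨S.1, S.2, fun f hf => ?_⟩
  rcases eq_or_ne f 0 with rfl | hf0
  · simp
  have h := ciInf_le (f := fun f : {f : E // f ∈ S.1 ∧ ‖f‖ = 1} => ‖A f.1‖ ^ 2)
    ⟨0, by rintro _ ⟨g, rfl⟩; positivity⟩
    ⟨‖f‖⁻¹ • f, S.1.smul_mem _ hf, norm_smul_inv_norm (𝕜 := ℝ) hf0⟩
  have h1 := hS.le.trans h
  have hfpos : 0 < ‖f‖ := norm_pos_iff.2 hf0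
  simp only [map_smul, norm_smul, norm_inv, norm_norm, mul_pow, inv_pow] at h1
  rwa [inv_mul_eq_div, le_div_iff₀ (by positivity)] at h1

lemma finrank_map_of_forall_mul_le {A : E →L[ℝ] H} {S : Submodule ℝ E} {c : ℝ} (hc0 : 0 < c)
    (hc : ∀ f ∈ S, c * ‖f‖ ^ 2 ≤ ‖A f‖ ^ 2) :
    Module.finrank ℝ (S.map (A : E →ₗ[ℝ] H)) = Module.finrank ℝ S := by
  rw [← LinearMap.range_domRestrict]
  refine LinearMap.finrank_range_of_inj ((injective_iff_map_eq_zero _).2 fun f hf => ?_)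
  have hAf : A f.1 = 0 := hf
  have h := hc f.1 f.2
  rw [hAf] at h
  have : ‖f.1‖ ^ 2 ≤ 0 := by
    by_contra! h'
    have := mul_pos hc0 h'
    simp at h
    linarith
  have h0 : ‖f.1‖ = 0 := pow_eq_zero_iff two_ne_zero |>.1 (le_antisymm this (sq_nonneg _))
  exact Subtype.ext (norm_eq_zero.1 h0)

lemma mul_norm_sq_le_adjoint_of_mem_map [CompleteSpace E] [CompleteSpace H] {A : E →L[ℝ] H}
    {S : Submodule ℝ E} {c : ℝ} (hc0 : 0 ≤ c) (hc : ∀ f ∈ S, c * ‖f‖ ^ 2 ≤ ‖A f‖ ^ 2) :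
    ∀ h ∈ S.map (A : E →ₗ[ℝ] H), c * ‖h‖ ^ 2 ≤ ‖A.adjoint h‖ ^ 2 := by
  rintro _ ⟨f, hf, rfl⟩
  change c * ‖A f‖ ^ 2 ≤ ‖A.adjoint (A f)‖ ^ 2
  rcases eq_or_ne (A f) 0 with h0 | h0
  · simp [h0]
  have hpos : 0 < ‖A f‖ ^ 2 := by positivity
  have h1 : ‖A f‖ ^ 2 ≤ ‖A.adjoint (A f)‖ * ‖f‖ := by
    rw [← real_inner_self_eq_norm_sq, ← ContinuousLinearMap.adjoint_inner_left]
    exact real_inner_le_norm _ _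
  have h2 := pow_le_pow_left₀ hpos.le h1 2
  refine le_of_mul_le_mul_right ?_ hpos
  calc c * ‖A f‖ ^ 2 * ‖A f‖ ^ 2 = c * (‖A f‖ ^ 2) ^ 2 := by ring
    _ ≤ c * (‖A.adjoint (A f)‖ * ‖f‖) ^ 2 := by gcongr
    _ = ‖A.adjoint (A f)‖ ^ 2 * (c * ‖f‖ ^ 2) := by ring
    _ ≤ ‖A.adjoint (A f)‖ ^ 2 * ‖A f‖ ^ 2 := by gcongr; exact hc f hf

/-- The Courant–Fischer values of `A₁* A₁` and `A₂* A₂` differ by at most the distance of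
`A₁ A₁*` and `A₂ A₂*` in the sense of quadratic forms. -/
lemma cfSup_norm_sq_le_add [CompleteSpace E₁] [CompleteSpace E₂] [CompleteSpace H]
    (A₁ : E₁ →L[ℝ] H) (A₂ : E₂ →L[ℝ] H) {D : ℝ} (hD : 0 ≤ D)
    (h : ∀ v, ‖A₁.adjoint v‖ ^ 2 - ‖A₂.adjoint v‖ ^ 2 ≤ D * ‖v‖ ^ 2) {i : ℕ} (hi : 1 ≤ i) :
    cfSup (fun f => ‖A₁ f‖ ^ 2) i ≤ cfSup (fun f => ‖A₂ f‖ ^ 2) i + D := by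
  refine le_of_forall_lt fun c hc => ?_
  obtain ⟨c', hcc', hc'⟩ := exists_between hc
  refine hcc'.trans_le ?_
  rcases le_or_gt c' D with hcD | hcD
  · have : 0 ≤ cfSup (fun f => ‖A₂ f‖ ^ 2) i :=
      Real.iSup_nonneg fun S => Real.iInf_nonneg fun f => sq_nonneg _
    linarith
  obtain ⟨S, hS, hSc⟩ := exists_of_lt_cfSup_norm_sq A₁ (hD.trans hcD.le) hc'
  have hT := finrank_map_of_forall_mul_le (hD.trans_lt hcD) hSc
  have hTc := mul_norm_sq_le_adjoint_of_mem_map (hD.trans hcD.le) hSc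
  have hTc' : ∀ v ∈ S.map (A₁ : E₁ →ₗ[ℝ] H), (c' - D) * ‖v‖ ^ 2 ≤ ‖A₂.adjoint v‖ ^ 2 := by
    intro v hv
    linarith [hTc v hv, h v]
  have hU := finrank_map_of_forall_mul_le (sub_pos.2 hcD) hTc'
  have hUc := mul_norm_sq_le_adjoint_of_mem_map (sub_pos.2 hcD).le hTc'
  rw [ContinuousLinearMap.adjoint_adjoint] at hUc
  linarith [le_cfSup_norm_sq A₂ hi (hU.trans (hT.trans hS)) hUc]

end CourantFischer

/-- Moore–Aronszajn: a positive semidefinite kernel is the Gram kernel of a feature map. -/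
lemma exists_feature_map {X : Type} {K : X → X → ℝ}
    (hK : ∀ (N : ℕ) (z : Fin N → X), (Matrix.of fun i j : Fin N => K (z i) (z j)).PosSemidef) :
    ∃ (H : Type) (_ : NormedAddCommGroup H) (_ : InnerProductSpace ℝ H) (_ : CompleteSpace H)
      (Φ : X → H), ∀ x y, inner ℝ (Φ x) (Φ y) = K x y := by
  have hsymm : ∀ x y, K x y = K y x := fun x y => by
    simpa using ((hK 2 ![x, y]).isHermitian.apply 1 0)
  let L : Matrix X X (ℝ →L[ℝ] ℝ) := .of fun x y => K x y • ContinuousLinearMap.id ℝ ℝ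
  have hL : L.PosSemidef := by
    have htfae := (RKHS.posSemidef_tfae (K := L)).out 0 2
    refine htfae.mpr ⟨?_, fun v => ?_⟩
    · ext x y
      simp [L, Matrix.conjTranspose_apply, hsymm y x, ContinuousLinearMap.star_eq_adjoint,
        ContinuousLinearMap.adjoint_id]
    · let e := v.support.equivFin
      have h := (hK _ fun i => (e.symm i : X)).dotProduct_mulVec_nonneg fun i => v (e.symm i)
      simp only [dotProduct, Matrix.mulVec, Matrix.of_apply, Finset.mul_sum, star_trivial,
        Pi.star_apply] at h
      refine h.trans_eq ?_
      simp only [Finsupp.sum, L, Matrix.of_apply]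
      rw [← Finset.sum_coe_sort v.support, ← e.symm.sum_comp]
      refine Finset.sum_congr rfl fun i _ => ?_
      rw [← Finset.sum_coe_sort v.support, ← e.symm.sum_comp]
      refine Finset.sum_congr rfl fun j _ => ?_
      simp [hsymm (e.symm i)]
      ring
  have : Fact L.PosSemidef := ⟨hL⟩
  refine ⟨RKHS.OfKernel L, inferInstance, inferInstance, inferInstance,
    fun x => RKHS.kerFun (RKHS.OfKernel L) x 1, fun x y => ?_⟩
  rw [← RKHS.kernel_inner, RKHS.OfKernel.kernel_ofKernel]
  simp [L, hsymm x y]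

/-- The feature map `v ↦ v ⊗ v` of the squared inner product. -/
lemma exists_square_feature_map (H : Type) [NormedAddCommGroup H] [InnerProductSpace ℝ H] :
    ∃ (G : Type) (_ : NormedAddCommGroup G) (_ : InnerProductSpace ℝ G) (_ : CompleteSpace G)
      (Ψ : H → G), Continuous Ψ ∧ ∀ v w, inner ℝ (Ψ v) (Ψ w) = inner ℝ v w ^ 2 := by
  refine ⟨UniformSpace.Completion (TensorProduct ℝ H H), inferInstance, inferInstance,
    inferInstance, fun v => ((v ⊗ₜ[ℝ] v : TensorProduct ℝ H H) :
      UniformSpace.Completion (TensorProduct ℝ H H)), ?_, fun v w => ?_⟩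
  · exact (UniformSpace.Completion.continuous_coe _).comp
      (TensorProduct.continuous_tmul.comp (continuous_id.prodMk continuous_id))
  · rw [UniformSpace.Completion.inner_coe, TensorProduct.inner_tmul, sq]

section Sampling

variable {X H : Type} [MeasurableSpace X] [NormedAddCommGroup H] [InnerProductSpace ℝ H]

lemma norm_sq_eq_integral_of_ae_eq {V : Measure X} {Φ : X → H} {B : H →L[ℝ] Lp ℝ 2 V}
    (hB : ∀ v, B v =ᵐ[V] fun x => inner ℝ (Φ x) v) (v : H) :
    ‖B v‖ ^ 2 = ∫ x, inner ℝ (Φ x) v ^ 2 ∂V := by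
  rw [← real_inner_self_eq_norm_sq, L2.inner_def]
  refine integral_congr_ae ?_
  filter_upwards [hB v] with x hx
  rw [hx, real_inner_self_eq_norm_sq, Real.norm_eq_abs, sq_abs]

lemma integral_kernel_eq_norm_adjoint_sq [CompleteSpace H] {V : Measure X} {Φ : X → H}
    {B : H →L[ℝ] Lp ℝ 2 V} (hB : ∀ v, B v =ᵐ[V] fun x => inner ℝ (Φ x) v) (f : Lp ℝ 2 V) :
    ∫ x, (∫ y, inner ℝ (Φ x) (Φ y) * f y ∂V) * f x ∂V = ‖B.adjoint f‖ ^ 2 := by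
  rw [← real_inner_self_eq_norm_sq, ContinuousLinearMap.adjoint_inner_right, L2.inner_def]
  refine integral_congr_ae ?_
  filter_upwards [hB (B.adjoint f)] with x hx
  have h : inner ℝ (Φ x) (B.adjoint f) = ∫ y, inner ℝ (Φ x) (Φ y) * f y ∂V := by
    rw [ContinuousLinearMap.adjoint_inner_right, L2.inner_def]
    refine integral_congr_ae ?_
    filter_upwards [hB (Φ x)] with y hy
    rw [hy, real_inner_comm (Φ x) (Φ y)]
    simp [mul_comm]
  rw [hx, h]
  simp [mul_comm]

/-- The synthesis operator `u ↦ n^{-1/2} ∑ a, u a • φ a`. -/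
noncomputable def synthesis {n : ℕ} (φ : Fin n → H) : EuclideanSpace ℝ (Fin n) →L[ℝ] H :=
  ∑ a, (EuclideanSpace.proj a : EuclideanSpace ℝ (Fin n) →L[ℝ] ℝ).smulRight ((√n)⁻¹ • φ a)

lemma synthesis_apply {n : ℕ} (φ : Fin n → H) (u : EuclideanSpace ℝ (Fin n)) :
    synthesis φ u = ∑ a, u a • (√n)⁻¹ • φ a := by
  simp [synthesis]

lemma norm_synthesis_sq {n : ℕ} (φ : Fin n → H) (u : EuclideanSpace ℝ (Fin n)) :
    ‖synthesis φ u‖ ^ 2 = ∑ a, ∑ b, (1 / (n : ℝ)) * inner ℝ (φ a) (φ b) * u a * u b := by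
  have h : (√(n : ℝ))⁻¹ * (√(n : ℝ))⁻¹ = 1 / n := by
    rw [← mul_inv, Real.mul_self_sqrt (Nat.cast_nonneg n), one_div]
  rw [← real_inner_self_eq_norm_sq, synthesis_apply]
  simp only [sum_inner, inner_sum, real_inner_smul_left, real_inner_smul_right, ← h]
  refine Finset.sum_congr rfl fun a _ => Finset.sum_congr rfl fun b _ => ?_
  rw [real_inner_comm (φ b)]
  ring

lemma norm_adjoint_synthesis_sq [CompleteSpace H] {n : ℕ} (φ : Fin n → H) (v : H) :
    ‖(synthesis φ).adjoint v‖ ^ 2 = (1 / (n : ℝ)) * ∑ a, inner ℝ (φ a) v ^ 2 := by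
  have h : ∀ a, (synthesis φ).adjoint v a = (√n)⁻¹ * inner ℝ (φ a) v := fun a => by
    have h1 : (synthesis φ).adjoint v a =
        inner ℝ (EuclideanSpace.single a (1 : ℝ)) ((synthesis φ).adjoint v) := by
      simp [EuclideanSpace.inner_single_left]
    rw [h1, ContinuousLinearMap.adjoint_inner_right, synthesis_apply]
    simp [real_inner_smul_left]
  rw [EuclideanSpace.norm_sq_eq, Finset.mul_sum]
  refine Finset.sum_congr rfl fun a _ => ?_
  rw [h, Real.norm_eq_abs, sq_abs, mul_pow, inv_pow, Real.sq_sqrt (Nat.cast_nonneg n), one_div]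

variable [TopologicalSpace X] [CompactSpace X] [BorelSpace X]

lemma exists_inner_feature_toLp (V : Measure X) [IsProbabilityMeasure V] {Φ : X → H}
    (hΦ : Continuous Φ) {C : ℝ} (hC : ∀ x, ‖Φ x‖ ≤ C) :
    ∃ B : H →L[ℝ] Lp ℝ 2 V, ∀ v, B v =ᵐ[V] fun x => inner ℝ (Φ x) v := by
  let L : H →ₗ[ℝ] C(X, ℝ) :=
    { toFun := fun v => ⟨fun x => inner ℝ (Φ x) v, by fun_prop⟩
      map_add' := fun v w => by ext x; simp [inner_add_right]
      map_smul' := fun c v => by ext x; simp [inner_smul_right] }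
  refine ⟨(ContinuousMap.toLp 2 V ℝ).comp (L.mkContinuous (max C 0) fun v => ?_), fun v => ?_⟩
  · rw [ContinuousMap.norm_le _ (by positivity)]
    intro x
    refine (norm_inner_le_norm (𝕜 := ℝ) (Φ x) v).trans ?_
    gcongr
    exact (hC x).trans (le_max_left _ _)
  · exact ContinuousMap.coeFn_toLp V (L v)

lemma abs_cfSup_sub_cfSup_le [CompleteSpace H] (V : Measure X) [IsProbabilityMeasure V] {Φ : X → H}
    (hΦ : Continuous Φ) {C : ℝ} (hC : ∀ x, ‖Φ x‖ ≤ C) {n : ℕ} (ω : Fin n → X) {D : ℝ} (hD : 0 ≤ D)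
    (h : ∀ v, |∫ x, inner ℝ (Φ x) v ^ 2 ∂V - (1 / (n : ℝ)) * ∑ a, inner ℝ (Φ (ω a)) v ^ 2| ≤
      D * ‖v‖ ^ 2) {i : ℕ} (hi : 1 ≤ i) :
    |cfSup (fun f : Lp ℝ 2 V => ∫ x, (∫ y, inner ℝ (Φ x) (Φ y) * f y ∂V) * f x ∂V) i -
      cfSup (fun u : EuclideanSpace ℝ (Fin n) =>
        ∑ a, ∑ b, (1 / (n : ℝ)) * inner ℝ (Φ (ω a)) (Φ (ω b)) * u a * u b) i| ≤ D := by
  obtain ⟨B, hB⟩ := exists_inner_feature_toLp V hΦ hC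
  have h1 : (fun f : Lp ℝ 2 V => ∫ x, (∫ y, inner ℝ (Φ x) (Φ y) * f y ∂V) * f x ∂V) =
      fun f => ‖B.adjoint f‖ ^ 2 := funext (integral_kernel_eq_norm_adjoint_sq hB)
  have h2 : (fun u : EuclideanSpace ℝ (Fin n) =>
        ∑ a, ∑ b, (1 / (n : ℝ)) * inner ℝ (Φ (ω a)) (Φ (ω b)) * u a * u b) =
      fun u => ‖synthesis (fun a => Φ (ω a)) u‖ ^ 2 :=
    funext fun u => (norm_synthesis_sq (fun a => Φ (ω a)) u).symm
  have h3 : ∀ v, |‖B.adjoint.adjoint v‖ ^ 2 - ‖(synthesis fun a => Φ (ω a)).adjoint v‖ ^ 2| ≤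
      D * ‖v‖ ^ 2 := fun v => by
    rw [ContinuousLinearMap.adjoint_adjoint, norm_sq_eq_integral_of_ae_eq hB,
      norm_adjoint_synthesis_sq]
    exact h v
  rw [h1, h2, abs_sub_le_iff, sub_le_iff_le_add', sub_le_iff_le_add']
  exact ⟨cfSup_norm_sq_le_add _ _ hD (fun v => (abs_le.1 (h3 v)).2) hi,
    cfSup_norm_sq_le_add _ _ hD
      (fun v => (neg_sub (‖_‖ ^ 2 : ℝ) _).symm.trans_le (neg_le.1 (abs_le.1 (h3 v)).1)) hi⟩

variable [SecondCountableTopology X]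

/-- Concentration of the Courant–Fischer values of the empirical kernel matrix around those of the
integral operator, for a continuous positive semidefinite kernel. -/
lemma measure_not_abs_cfSup_sub_le (V : Measure X) [IsProbabilityMeasure V] {K : X → X → ℝ}
    (hK : ∀ (N : ℕ) (z : Fin N → X), (Matrix.of fun i j : Fin N => K (z i) (z j)).PosSemidef)
    (hcont : Continuous fun p : X × X => K p.1 p.2) {κ : ℝ} (hκ0 : 0 < κ) (hκ : ∀ x, K x x ≤ κ)
    {n : ℕ} (hn : 0 < n) {s : ℝ} (hs : 0 ≤ s) :
    (Measure.pi fun _ : Fin n => V).real {ω | ∀ i : ℕ, 1 ≤ i →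
      |cfSup (fun f : Lp ℝ 2 V => ∫ x, (∫ y, K x y * f y ∂V) * f x ∂V) i -
        cfSup (fun u : EuclideanSpace ℝ (Fin n) =>
          ∑ a, ∑ b, (1 / (n : ℝ)) * K (ω a) (ω b) * u a * u b) i| ≤ s / n}ᶜ ≤
      2 * exp (-(s ^ 2 / (2 * n * (2 * κ) ^ 2))) := by
  obtain ⟨H, _, _, _, Φ, hΦK⟩ := exists_feature_map hK
  obtain ⟨G, _, _, _, Ψ, hΨ, hΨin⟩ := exists_square_feature_map H
  have hn' : (0 : ℝ) < n := by exact_mod_cast hn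
  have hΨnorm : ∀ v, ‖Ψ v‖ = ‖v‖ ^ 2 := fun v => by
    rw [← sq_eq_sq₀ (norm_nonneg _) (sq_nonneg _), ← real_inner_self_eq_norm_sq, hΨin,
      real_inner_self_eq_norm_sq]
  have hΦsq : ∀ x, ‖Φ x‖ ^ 2 ≤ κ := fun x => by
    rw [← real_inner_self_eq_norm_sq, hΦK]; exact hκ x
  have hΦ : Continuous Φ := by
    refine continuous_iff_continuousAt.2 fun x => ?_
    rw [ContinuousAt, tendsto_iff_norm_sub_tendsto_zero]
    have h1 : ∀ y, ‖Φ y - Φ x‖ = √(K y y - 2 * K y x + K x x) := fun y => by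
      rw [← hΦK, ← hΦK, ← hΦK, real_inner_self_eq_norm_sq, real_inner_self_eq_norm_sq,
        ← norm_sub_sq_real, Real.sqrt_sq (norm_nonneg _)]
    have h2 : Continuous fun y => √(K y y - 2 * K y x + K x x) := by
      have ha : Continuous fun y => K y y := hcont.comp (continuous_id.prodMk continuous_id)
      have hb : Continuous fun y => K y x := hcont.comp (continuous_id.prodMk continuous_const)
      fun_prop
    have h3 := h2.tendsto x
    simp only [h1]
    convert! h3 using 2
    rw [eq_comm, Real.sqrt_eq_zero']
    linarith
  have hΨΦ : Integrable (fun x => Ψ (Φ x)) V :=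
    (hΨ.comp hΦ).integrable_of_hasCompactSupport (HasCompactSupport.of_compactSpace _)
  set m := ∫ x, Ψ (Φ x) ∂V with hm
  have hm_norm : ‖m‖ ≤ κ := by
    have := norm_integral_le_of_norm_le_const (μ := V) (f := fun x => Ψ (Φ x)) (C := κ)
      (ae_of_all _ fun x => (hΨnorm _).trans_le (hΦsq x))
    simpa using this
  have hξ : Continuous fun x => Ψ (Φ x) - m := (hΨ.comp hΦ).sub continuous_const
  have hmean : ∫ x, (Ψ (Φ x) - m) ∂V = 0 := by
    rw [integral_sub hΨΦ (integrable_const _)]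
    simp [hm]
  have hR : ∀ x, ‖Ψ (Φ x) - m‖ ≤ 2 * κ := fun x =>
    (norm_sub_le _ _).trans (by linarith [(hΨnorm (Φ x)).trans_le (hΦsq x)])
  refine (measureReal_mono fun ω hω => ?_).trans
    (measure_le_norm_sum_le V hξ hmean (by positivity : 0 < 2 * κ) hR hn hs)
  by_contra hlt
  simp only [Set.mem_ofPred_eq, not_le] at hlt
  refine hω fun i hi => ?_
  have hsum : ∑ a, (Ψ (Φ (ω a)) - m) = ∑ a, Ψ (Φ (ω a)) - (n : ℝ) • m := by
    simp [Finset.sum_sub_distrib, ← Nat.cast_smul_eq_nsmul ℝ]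
  simp only [← hΦK]
  refine abs_cfSup_sub_cfSup_le V hΦ (C := √κ) (fun x => Real.le_sqrt_of_sq_le (hΦsq x)) ω
    (by positivity) (fun v => ?_) hi
  have h1 : ∫ x, inner ℝ (Φ x) v ^ 2 ∂V = inner ℝ (Ψ v) m := by
    rw [hm, ← integral_inner hΨΦ]
    simp only [hΨin, real_inner_comm v]
  have h2 : ∑ a, inner ℝ (Φ (ω a)) v ^ 2 = inner ℝ (Ψ v) (∑ a, Ψ (Φ (ω a))) := by
    simp only [inner_sum, hΨin, real_inner_comm v]
  have h3 : ∫ x, inner ℝ (Φ x) v ^ 2 ∂V - (1 / (n : ℝ)) * ∑ a, inner ℝ (Φ (ω a)) v ^ 2 =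
      -((1 / (n : ℝ)) * inner ℝ (Ψ v) (∑ a, (Ψ (Φ (ω a)) - m))) := by
    rw [h1, h2, hsum, inner_sub_right, real_inner_smul_right]
    field_simp
    ring
  rw [h3, abs_neg, abs_mul, abs_of_nonneg (by positivity : 0 ≤ 1 / (n : ℝ))]
  calc 1 / (n : ℝ) * |inner ℝ (Ψ v) (∑ a, (Ψ (Φ (ω a)) - m))|
      ≤ 1 / (n : ℝ) * (‖v‖ ^ 2 * s) := by
        gcongr
        refine (abs_real_inner_le_norm _ _).trans ?_
        rw [hΨnorm]
        gcongr
    _ = s / n * ‖v‖ ^ 2 := by ring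

end Sampling

theorem statement_0
    {m d : ℕ} (hd : 1 ≤ d)
    (M : Set (EuclideanSpace ℝ (Fin m))) (hMcomp : IsCompact M)
    (V : Measure M) [IsProbabilityMeasure V]
    (hsupp : ∀ U : Set M, IsOpen U → U.Nonempty → 0 < V U)
    (ε m₂ : ℝ) (hε : 0 < ε) (hm₂ : 0 < m₂)
    -- the Gaussian kernel
    (k : M → M → ℝ)
    (hk : ∀ x y, k x y =
      Real.exp (-‖(x : EuclideanSpace ℝ (Fin m)) - (y : EuclideanSpace ℝ (Fin m))‖ ^ 2 / ε))
    -- the degree function d(x) = K_ε 1 (x)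
    (deg : M → ℝ) (hdeg : ∀ x, deg x = ε ^ (-(d : ℝ) / 2) * ∫ y, k x y ∂V)
    (dmin : ℝ) (hdmin : dmin = ⨅ x : M, deg x) (hdminpos : 0 < dmin)
    -- the symmetrized kernel
    (khat : M → M → ℝ)
    (hkhat : ∀ x y, khat x y =
      ε ^ (-(d : ℝ) / 2) * k x y * (1 / (2 * deg x) + 1 / (2 * deg y)))
    -- the symmetrized kernel is positive semidefinite
    (hpsd : ∀ (N : ℕ) (z : Fin N → M),
      (Matrix.of fun i j : Fin N => khat (z i) (z j)).PosSemidef)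
    (n : ℕ) (hn : 1 ≤ n) :
    ENNReal.ofReal (1 - 2 / (n : ℝ) ^ 2) ≤
      (Measure.pi fun _ : Fin n => V)
        {ω : Fin n → M | ∀ i : ℕ, 1 ≤ i → i ≤ n →
          |(2 / (m₂ * ε)) * (1 -
              cfSup (fun f : Lp ℝ 2 V => ∫ x, (∫ y, khat x y * f y ∂V) * f x ∂V) i)
            - (2 / (m₂ * ε)) * (1 -
              cfSup (fun u : EuclideanSpace ℝ (Fin n) =>
                ∑ a : Fin n, ∑ b : Fin n, (1 / (n : ℝ)) * khat (ω a) (ω b) * u a * u b) i)|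
            ≤ 4 * Real.sqrt 2 * Real.sqrt (2 * Real.log n) /
                (m₂ * ε ^ ((d : ℝ) / 2 + 1) * Real.sqrt n * dmin)} := by
  have hn' : (0 : ℝ) < n := by exact_mod_cast hn
  have : CompactSpace M := isCompact_iff_compactSpace.1 hMcomp
  have hkc : Continuous fun p : M × M => k p.1 p.2 := by
    simp only [hk]
    fun_prop
  have hk1 : ∀ x y, ‖k x y‖ ≤ 1 := fun x y => by
    rw [hk, Real.norm_eq_abs, abs_of_pos (Real.exp_pos _), Real.exp_le_one_iff, neg_div]
    exact neg_nonpos.2 (by positivity)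
  have hεd : 0 < ε ^ (-(d : ℝ) / 2) := Real.rpow_pos_of_pos hε _
  have hdegc : Continuous deg := by
    have hdint : Continuous fun x => ∫ y, k x y ∂V :=
      continuous_of_dominated (bound := fun _ => 1)
        (fun x => (hkc.comp (continuous_const.prodMk continuous_id)).aestronglyMeasurable)
        (fun x => ae_of_all _ (hk1 x)) (integrable_const _)
        (ae_of_all _ fun y => hkc.comp (continuous_id.prodMk continuous_const))
    rw [funext hdeg]
    exact continuous_const.mul hdint
  have hdeg_le : ∀ x, dmin ≤ deg x := fun x => by
    rw [hdmin]
    refine ciInf_le ⟨0, ?_⟩ x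
    rintro _ ⟨y, rfl⟩
    beta_reduce
    rw [hdeg]
    refine mul_nonneg hεd.le (integral_nonneg fun z => ?_)
    rw [hk]
    exact (Real.exp_pos _).le
  have hdegpos : ∀ x, 0 < deg x := fun x => hdminpos.trans_le (hdeg_le x)
  have hkhatc : Continuous fun p : M × M => khat p.1 p.2 := by
    simp only [hkhat]
    refine (continuous_const.mul hkc).mul ((continuous_const.div ?_ ?_).add
      (continuous_const.div ?_ ?_))
    · fun_prop
    · exact fun p => (mul_pos two_pos (hdegpos p.1)).ne'
    · fun_prop
    · exact fun p => (mul_pos two_pos (hdegpos p.2)).ne'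
  set κ := ε ^ (-(d : ℝ) / 2) / dmin with hκ_def
  have hκ0 : 0 < κ := by positivity
  have hκ : ∀ x, khat x x ≤ κ := fun x => by
    have h1 : khat x x = ε ^ (-(d : ℝ) / 2) / deg x := by
      have := (hdegpos x).ne'
      rw [hkhat, hk]
      simp
      field_simp
      ring
    rw [h1]
    exact div_le_div_of_nonneg_left hεd.le hdminpos (hdeg_le x)
  set s := 2 * √2 * κ * √n * √(2 * Real.log n) with hs_def
  have hs : 0 ≤ s := by positivity
  have hlog : 0 ≤ Real.log n := Real.log_natCast_nonneg n
  have hexp : 2 * Real.exp (-(s ^ 2 / (2 * n * (2 * κ) ^ 2))) = 2 / (n : ℝ) ^ 2 := by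
    have h1 : s ^ 2 / (2 * n * (2 * κ) ^ 2) = Real.log ((n : ℝ) ^ 2) := by
      rw [hs_def, Real.log_pow]
      simp only [mul_pow]
      rw [Real.sq_sqrt (by positivity), Real.sq_sqrt (by positivity), Real.sq_sqrt (by positivity)]
      field_simp
      norm_num
      ring
    rw [h1, Real.exp_neg, Real.exp_log (by positivity), div_eq_mul_inv]
  have hbad := measure_not_abs_cfSup_sub_le V hpsd hkhatc hκ0 hκ hn hs
  rw [hexp] at hbad
  set T := {ω : Fin n → M | ∀ i : ℕ, 1 ≤ i →
      |cfSup (fun f : Lp ℝ 2 V => ∫ x, (∫ y, khat x y * f y ∂V) * f x ∂V) i -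
        cfSup (fun u : EuclideanSpace ℝ (Fin n) =>
          ∑ a, ∑ b, (1 / (n : ℝ)) * khat (ω a) (ω b) * u a * u b) i| ≤ s / n} with hT
  have hTmeas : 1 - 2 / (n : ℝ) ^ 2 ≤ (Measure.pi fun _ : Fin n => V).real T := by
    have h := measureReal_union_le (μ := Measure.pi fun _ : Fin n => V) T Tᶜ
    rw [Set.union_compl_self, probReal_univ] at h
    linarith
  have hbound : 2 / (m₂ * ε) * (s / n) =
      4 * √2 * √(2 * Real.log n) / (m₂ * ε ^ ((d : ℝ) / 2 + 1) * √n * dmin) := by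
    rw [hs_def, hκ_def, Real.rpow_add_one hε.ne', neg_div, Real.rpow_neg hε.le]
    have h1 : √(n : ℝ) ^ 2 = n := Real.sq_sqrt hn'.le
    have h2 : 0 < √(n : ℝ) := Real.sqrt_pos.2 hn'
    have h3 : 0 < ε ^ ((d : ℝ) / 2) := Real.rpow_pos_of_pos hε _
    field_simp
    rw [h1]
    ring
  refine ENNReal.ofReal_le_of_le_toReal (hTmeas.trans (measureReal_mono fun ω hω i hi _ => ?_))
  rw [← hbound, ← mul_sub, sub_sub_sub_cancel_left, abs_mul, abs_of_pos (by positivity),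
    abs_sub_comm]
  exact mul_le_mul_of_nonneg_left (hω i hi) (by positivity)
end

section
/- Let f, φ : M → ℝ be continuous, and let L̃_{ε,n} be the n×n matrix acting by (L̃_{ε,n} u)(x_i) := (2/(m₂ ε)) (u(x_i) − (1/n) Σ_{j=1}^n k̃_{ε,n}(x_i,x_j) u(x_j)), where k̃_{ε,n}(x_i,x_j) := k_ε(x_i,x_j) [ 1/((2/n) Σ_{k=1}^n k_ε(x_i,x_k)) + 1/((2/n) Σ_{k=1}^n k_ε(x_j,x_k)) ]. For each fixed ε > 0 there exist a constant C > 0 and N ∈ ℕ such that for all n ≥ N, with probability at least 1 − 6/n² over the i.i.d. sample x₁,…,xₙ drawn from V, |⟨L̃_{ε,n} R_n f, R_n φ⟩_{L²(μ_n)} − ∫_M (L_ε f)(y) φ(y) dV(y)| ≤ C (log n)^{3/2} / (ε^{d/2+1} √n). -/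
open MeasureTheory Real

section Concentration

open ProbabilityTheory

variable {α : Type*} [MeasurableSpace α] (V : Measure α) [IsProbabilityMeasure V]

/-- **Hoeffding's inequality** for the sum of a bounded function over an i.i.d. sample. -/
lemma measureReal_pi_le_sum_sub_integral_le {g : α → ℝ} (hg : Measurable g) {B : ℝ}
    (hB : ∀ x, |g x| ≤ B) {t : ℝ} (ht : 0 ≤ t) (n : ℕ) :
    (Measure.pi fun _ : Fin n => V).real {y | t ≤ ∑ a, (g (y a) - ∫ z, g z ∂V)}
      ≤ exp (-t ^ 2 / (2 * (n * B ^ 2))) := by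
  have hsub := hasSubgaussianMGF_of_mem_Icc (μ := V) (X := g) (a := -B) (b := B) hg.aemeasurable
    (Filter.Eventually.of_forall fun x => abs_le.mp (hB x))
  have hindep : iIndepFun (fun (i : Fin n) (y : Fin n → α) => g (y i) - ∫ z, g z ∂V)
      (Measure.pi fun _ : Fin n => V) :=
    iIndepFun_pi (μ := fun _ : Fin n => V) (X := fun _ x => g x - ∫ z, g z ∂V)
      fun _ => (hg.sub_const _).aemeasurable
  have key := HasSubgaussianMGF.measure_sum_ge_le_of_iIndepFun hindep
    (c := fun _ => (‖B - -B‖₊ / 2) ^ 2) (s := Finset.univ) (fun i _ => by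
      have hmap := (measurePreserving_eval (α := fun _ : Fin n => α) (fun _ => V) i).map_eq
      refine HasSubgaussianMGF.of_map (X := fun x : α => g x - ∫ z, g z ∂V)
        (Y := fun y : Fin n → α => y i) (measurable_pi_apply i).aemeasurable ?_
      rw [hmap]
      exact hsub) ht
  refine key.trans_eq ?_
  congr 2
  have : B - -B = 2 * B := by ring
  simp [this]

lemma measureReal_pi_le_abs_sum_sub_integral_le {g : α → ℝ} (hg : Measurable g) {B : ℝ}
    (hB : ∀ x, |g x| ≤ B) {t : ℝ} (ht : 0 ≤ t) (n : ℕ) :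
    (Measure.pi fun _ : Fin n => V).real {y | t ≤ |∑ a, (g (y a) - ∫ z, g z ∂V)|}
      ≤ 2 * exp (-t ^ 2 / (2 * (n * B ^ 2))) := by
  have hneg := measureReal_pi_le_sum_sub_integral_le V hg.neg (B := B) (by simpa using hB) ht n
  have hpos := measureReal_pi_le_sum_sub_integral_le V hg hB ht n
  refine (measureReal_mono (s₂ := {y | t ≤ ∑ a, (g (y a) - ∫ z, g z ∂V)} ∪
    {y | t ≤ ∑ a, ((-g) (y a) - ∫ z, (-g) z ∂V)}) ?_).trans
    ((measureReal_union_le _ _).trans (by linarith))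
  intro y (hy : t ≤ |_|)
  rcases le_abs.mp hy with h | h
  · exact Or.inl h
  · refine Or.inr ?_
    simp only [Pi.neg_apply, integral_neg, Set.mem_ofPred_eq]
    refine h.trans_eq ?_
    rw [← Finset.sum_neg_distrib]
    exact Finset.sum_congr rfl fun _ _ => by ring

/-- The empirical means of the sections `g (ω i)`, taken at the sample points themselves, are
simultaneously close to their expectations. -/
lemma measure_pi_exists_lt_abs_mean_sub_integral_le {g : α → α → ℝ}
    (hg : Measurable (Function.uncurry g)) {B : ℝ} (hBpos : 0 < B) (hB : ∀ x y, |g x y| ≤ B)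
    {n : ℕ} (hn : 3 ≤ n) :
    (Measure.pi fun _ : Fin n => V)
      {ω | ∃ i, 5 * B * √(log n / n) < |1 / (n : ℝ) * ∑ a, g (ω i) (ω a) - ∫ z, g (ω i) z ∂V|}
      ≤ ENNReal.ofReal (2 / (n : ℝ) ^ 2) := by
  obtain ⟨m, rfl⟩ : ∃ m, n = m + 1 := ⟨n - 1, by omega⟩
  have hm2 : (2 : ℝ) ≤ m := by
    have : 2 ≤ m := by omega
    exact_mod_cast this
  set n' : ℝ := ((m + 1 : ℕ) : ℝ) with hn'
  have hn'm : n' = m + 1 := by simp [n']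
  have hn'pos : 0 < n' := by rw [hn'm]; positivity
  have hlog : 1 ≤ log n' := by
    rw [le_log_iff_exp_le hn'pos]
    have := exp_one_lt_d9
    linarith
  set G : α → ℝ := fun x => ∫ z, g x z ∂V
  have hGm : Measurable G := hg.stronglyMeasurable.integral_prod_right.measurable
  have hGB : ∀ x, |G x| ≤ B := fun x => by
    have := norm_integral_le_of_norm_le_const (μ := V) (f := g x) (C := B)
      (Filter.Eventually.of_forall fun z => hB x z)
    simpa using this
  set s : ℝ := √(n' * log n') with hs
  have hs1 : 1 ≤ s := by
    rw [hs, one_le_sqrt]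
    nlinarith
  have hsn : n' * √(log n' / n') = s := by
    rw [hs, ← sqrt_sq hn'pos.le, ← sqrt_mul (by positivity), sqrt_sq hn'pos.le]
    congr 1
    field_simp
  set E : Set (α × (Fin m → α)) := {p | 3 * B * s ≤ |∑ a, (g p.1 (p.2 a) - G p.1)|}
  have hEm : MeasurableSet E := by
    refine measurableSet_le measurable_const ?_
    refine Measurable.abs ?_
    refine Finset.measurable_sum _ fun a _ => ?_
    refine Measurable.sub ?_ (hGm.comp measurable_fst)
    exact hg.comp (measurable_fst.prodMk ((measurable_pi_apply a).comp measurable_snd))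
  have hEle : (V.prod (Measure.pi fun _ : Fin m => V)) E ≤ ENNReal.ofReal (2 / n' ^ 3) := by
    rw [Measure.prod_apply hEm]
    have : ∀ x, (Measure.pi fun _ : Fin m => V) (Prod.mk x ⁻¹' E) ≤ ENNReal.ofReal (2 / n' ^ 3) := by
      intro x
      have h := measureReal_pi_le_abs_sum_sub_integral_le V (g := g x) (hg.of_uncurry_left)
        (hB x) (t := 3 * B * s) (by positivity) m
      rw [← ofReal_measureReal]
      refine ENNReal.ofReal_le_ofReal (h.trans ?_)
      have hexp : exp (-(3 * log n')) = 1 / n' ^ 3 := by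
        rw [exp_neg, mul_comm, exp_mul, exp_log hn'pos, one_div]
        norm_cast
      calc _ ≤ 2 * exp (-(3 * log n')) := by
            gcongr
            rw [neg_div, neg_le_neg_iff, le_div_iff₀ (by positivity)]
            have hs2 : s ^ 2 = n' * log n' := sq_sqrt (by positivity)
            have hx : 0 ≤ B ^ 2 * log n' := by positivity
            have : (3 * B * s) ^ 2 = 9 * n' * (B ^ 2 * log n') := by
              rw [mul_pow, hs2]; ring
            rw [this, hn'm]
            rw [hn'm] at hx
            nlinarith
        _ = _ := by rw [hexp]; ring
    calc _ ≤ ∫⁻ _, ENNReal.ofReal (2 / n' ^ 3) ∂V := lintegral_mono this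
      _ = _ := by simp
  have hsubset : {ω : Fin (m + 1) → α | ∃ i, 5 * B * √(log n' / n') <
      |1 / n' * ∑ a, g (ω i) (ω a) - ∫ z, g (ω i) z ∂V|} ⊆
      ⋃ i, MeasurableEquiv.piFinSuccAbove (fun _ => α) i ⁻¹' E := by
    rintro ω ⟨i, hi⟩
    refine Set.mem_iUnion.mpr ⟨i, ?_⟩
    change 3 * B * s ≤ |∑ a, (g (ω i) (ω (i.succAbove a)) - G (ω i))|
    have hi' : 5 * B * s < |∑ a, g (ω i) (ω a) - n' * G (ω i)| := by
      have h2 := mul_lt_mul_of_pos_left hi hn'pos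
      rw [← abs_of_pos hn'pos, ← abs_mul, abs_of_pos hn'pos] at h2
      calc 5 * B * s = n' * (5 * B * √(log n' / n')) := by rw [← hsn]; ring
        _ < _ := h2
        _ = _ := by
          congr 1
          rw [mul_sub, ← mul_assoc, mul_one_div_cancel hn'pos.ne', one_mul]
    have hsum : ∑ a, g (ω i) (ω a) - n' * G (ω i) =
        (g (ω i) (ω i) - G (ω i)) + ∑ a, (g (ω i) (ω (i.succAbove a)) - G (ω i)) := by
      rw [Fin.sum_univ_succAbove _ i, Finset.sum_sub_distrib, hn'm]
      simp
      ring
    rw [hsum] at hi'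
    have h1 := abs_add_le (g (ω i) (ω i) - G (ω i)) (∑ a, (g (ω i) (ω (i.succAbove a)) - G (ω i)))
    have h2 := abs_sub (g (ω i) (ω i)) (G (ω i))
    have h3 := hB (ω i) (ω i)
    have h4 := hGB (ω i)
    nlinarith
  calc _ ≤ ∑ i, (Measure.pi fun _ : Fin (m + 1) => V)
          (MeasurableEquiv.piFinSuccAbove (fun _ => α) i ⁻¹' E) :=
        (measure_mono hsubset).trans (measure_iUnion_fintype_le _ _)
    _ ≤ ∑ _i : Fin (m + 1), ENNReal.ofReal (2 / n' ^ 3) := by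
        refine Finset.sum_le_sum fun i _ => ?_
        rw [(measurePreserving_piFinSuccAbove (fun _ : Fin (m + 1) => V) i).measure_preimage
          hEm.nullMeasurableSet]
        exact hEle
    _ = ENNReal.ofReal (2 / n' ^ 2) := by
        rw [Finset.sum_const, Finset.card_univ, Fintype.card_fin, ← ENNReal.ofReal_nsmul,
          nsmul_eq_mul]
        congr 1
        rw [← hn']
        field_simp

end Concentration

lemma abs_mean_le {n : ℕ} {a : Fin n → ℝ} {b : ℝ} (hb : 0 ≤ b) (h : ∀ i, |a i| ≤ b) :
    |1 / (n : ℝ) * ∑ i, a i| ≤ b := by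
  rcases Nat.eq_zero_or_pos n with rfl | hn
  · simpa using hb
  have hn' : (0 : ℝ) < n := by exact_mod_cast hn
  rw [abs_mul, abs_of_pos (by positivity : 0 < 1 / (n : ℝ)), one_div, inv_mul_le_iff₀ hn']
  calc |∑ i, a i| ≤ ∑ i, |a i| := Finset.abs_sum_le_sum_abs _ _
    _ ≤ ∑ _i : Fin n, b := Finset.sum_le_sum fun i _ => h i
    _ = n * b := by simp

lemma abs_one_div_two_mul_sub_le {x y κ δ : ℝ} (hκ : 0 < κ) (hx : κ ≤ x) (hy : κ ≤ y)
    (h : |x - y| ≤ δ) : |1 / (2 * x) - 1 / (2 * y)| ≤ δ / (2 * κ ^ 2) := by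
  have hx0 := hκ.trans_le hx
  have hy0 := hκ.trans_le hy
  have : 1 / (2 * x) - 1 / (2 * y) = (y - x) / (2 * (x * y)) := by field_simp
  rw [this, abs_div, abs_sub_comm, abs_of_pos (by positivity : 0 < 2 * (x * y))]
  have : κ ^ 2 ≤ x * y := by nlinarith
  gcongr
  exact (abs_nonneg _).trans h

/-- Deterministic stability of the quadratic form of the symmetrically normalized graph
Laplacian under perturbation of the degrees and of the empirical means. -/
lemma abs_laplacianForm_sub_le {n : ℕ} {K : Fin n → Fin n → ℝ} {f φ dn D H : Fin n → ℝ}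
    {F P κ δ I : ℝ} (hF : 0 ≤ F) (hP : 0 ≤ P) (hκ : 0 < κ) (hδ : 0 ≤ δ)
    (hK : ∀ i j, |K i j| ≤ 1) (hf : ∀ i, |f i| ≤ F) (hφ : ∀ i, |φ i| ≤ P)
    (hdn : ∀ i, κ ≤ dn i) (hD : ∀ i, κ ≤ D i) (hdD : ∀ i, |dn i - D i| ≤ δ)
    (hH : ∀ i, |1 / (n : ℝ) * ∑ j, K i j * (1 / (2 * D i) + 1 / (2 * D j)) * f j - H i| ≤ δ)
    (hI : |1 / (n : ℝ) * ∑ i, (f i - H i) * φ i - I| ≤ δ) :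
    |1 / (n : ℝ) * ∑ i, (f i - 1 / (n : ℝ) * ∑ j, K i j * (1 / (2 * dn i) + 1 / (2 * dn j)) * f j)
      * φ i - I| ≤ (F / κ ^ 2 * P + P + 1) * δ := by
  set S : Fin n → ℝ := fun i => 1 / (n : ℝ) * ∑ j, K i j * (1 / (2 * dn i) + 1 / (2 * dn j)) * f j
  set T : Fin n → ℝ := fun i => 1 / (n : ℝ) * ∑ j, K i j * (1 / (2 * D i) + 1 / (2 * D j)) * f j
  have hST : ∀ i, |T i - S i| ≤ F / κ ^ 2 * δ := by
    intro i
    have : T i - S i = 1 / (n : ℝ) * ∑ j, K i j *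
        ((1 / (2 * D i) - 1 / (2 * dn i)) + (1 / (2 * D j) - 1 / (2 * dn j))) * f j := by
      simp only [T, S]
      rw [← mul_sub, ← Finset.sum_sub_distrib]
      congr 1
      exact Finset.sum_congr rfl fun _ _ => by ring
    rw [this]
    refine abs_mean_le (by positivity) fun j => ?_
    have h1 := abs_one_div_two_mul_sub_le hκ (hD i) (hdn i) ((abs_sub_comm _ _).trans_le (hdD i))
    have h2 := abs_one_div_two_mul_sub_le hκ (hD j) (hdn j) ((abs_sub_comm _ _).trans_le (hdD j))
    rw [abs_mul, abs_mul]
    calc _ ≤ 1 * (δ / (2 * κ ^ 2) + δ / (2 * κ ^ 2)) * F := by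
          gcongr
          · exact hK i j
          · exact (abs_add_le _ _).trans (add_le_add h1 h2)
          · exact hf j
      _ = _ := by field_simp; ring
  have hmean : |1 / (n : ℝ) * ∑ i, (H i - S i) * φ i| ≤ (F / κ ^ 2 * δ + δ) * P := by
    refine abs_mean_le (by positivity) fun i => ?_
    rw [abs_mul]
    gcongr
    · have h1 := abs_sub_le (H i) (T i) (S i)
      have h2 := hH i
      rw [abs_sub_comm] at h2
      linarith [hST i]
    · exact hφ i
  have hsplit : 1 / (n : ℝ) * ∑ i, (f i - S i) * φ i - I =
      (1 / (n : ℝ) * ∑ i, (f i - H i) * φ i - I) + 1 / (n : ℝ) * ∑ i, (H i - S i) * φ i := by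
    have : ∑ i, (f i - S i) * φ i = ∑ i, (f i - H i) * φ i + ∑ i, (H i - S i) * φ i := by
      rw [← Finset.sum_add_distrib]
      exact Finset.sum_congr rfl fun _ _ => by ring
    rw [this]; ring
  rw [hsplit]
  refine (abs_add_le _ _).trans ?_
  calc _ ≤ δ + (F / κ ^ 2 * δ + δ) * P := add_le_add hI hmean
    _ = _ := by ring

open MeasureTheory Real

theorem statement_9
    {m d : ℕ} (hd : 1 ≤ d)
    (M : Set (EuclideanSpace ℝ (Fin m))) (hMcomp : IsCompact M)
    (V : Measure M) [IsProbabilityMeasure V]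
    (hsupp : ∀ U : Set M, IsOpen U → U.Nonempty → 0 < V U)
    (ε m₂ : ℝ) (hε : 0 < ε) (hm₂ : 0 < m₂)
    -- the Gaussian kernel
    (k : M → M → ℝ)
    (hk : ∀ x y, k x y =
      Real.exp (-‖(x : EuclideanSpace ℝ (Fin m)) - (y : EuclideanSpace ℝ (Fin m))‖ ^ 2 / ε))
    -- the degree function d(x) = K_ε 1 (x)
    (deg : M → ℝ) (hdeg : ∀ x, deg x = ε ^ (-(d : ℝ) / 2) * ∫ y, k x y ∂V)
    (dmin : ℝ) (hdmin : dmin = ⨅ x : M, deg x) (hdminpos : 0 < dmin)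
    -- the symmetrized kernel
    (khat : M → M → ℝ)
    (hkhat : ∀ x y, khat x y =
      ε ^ (-(d : ℝ) / 2) * k x y * (1 / (2 * deg x) + 1 / (2 * deg y)))
    (f φ : M → ℝ) (hf : Continuous f) (hφ : Continuous φ) :
    ∃ C : ℝ, 0 < C ∧ ∃ N : ℕ, ∀ n : ℕ, N ≤ n →
      ENNReal.ofReal (1 - 6 / (n : ℝ) ^ 2) ≤
        (Measure.pi fun _ : Fin n => V)
          {ω : Fin n → M |
            |(1 / (n : ℝ)) * ∑ i : Fin n,
                ((2 / (m₂ * ε)) * (f (ω i) - (1 / (n : ℝ)) * ∑ j : Fin n,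
                    (k (ω i) (ω j) *
                      (1 / ((2 / (n : ℝ)) * ∑ a : Fin n, k (ω i) (ω a)) +
                       1 / ((2 / (n : ℝ)) * ∑ a : Fin n, k (ω j) (ω a)))) * f (ω j)))
                  * φ (ω i)
              - ∫ y, ((2 / (m₂ * ε)) * (f y - ∫ z, khat y z * f z ∂V)) * φ y ∂V|
              ≤ C * Real.log n ^ ((3 : ℝ) / 2) / (ε ^ ((d : ℝ) / 2 + 1) * Real.sqrt n)} := by
  have : CompactSpace M := isCompact_iff_compactSpace.mp hMcomp
  have : Nonempty M := nonempty_of_isProbabilityMeasure V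
  have hkc : Continuous (Function.uncurry k) := by
    have : Function.uncurry k = fun p : M × M => Real.exp
        (-‖(p.1 : EuclideanSpace ℝ (Fin m)) - (p.2 : EuclideanSpace ℝ (Fin m))‖ ^ 2 / ε) := by
      ext ⟨x, y⟩
      exact hk x y
    rw [this]
    fun_prop
  have hkpos : ∀ x y, 0 < k x y := fun x y => by rw [hk]; positivity
  have hk1 : ∀ x y, k x y ≤ 1 := fun x y => by
    rw [hk, exp_le_one_iff, neg_div, neg_nonpos]
    positivity
  have hkabs : ∀ x y, |k x y| ≤ 1 := fun x y => by
    rw [abs_of_pos (hkpos x y)]; exact hk1 x y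
  obtain ⟨κ, hκ, hκk⟩ : ∃ κ, 0 < κ ∧ ∀ x y, κ ≤ k x y := by
    obtain ⟨p, -, hp⟩ := isCompact_univ.exists_isMinOn Set.univ_nonempty hkc.continuousOn
    exact ⟨k p.1 p.2, hkpos _ _, fun x y => hp (Set.mem_univ (x, y))⟩
  obtain ⟨F, hF, hfF⟩ : ∃ F, 0 ≤ F ∧ ∀ x, |f x| ≤ F := by
    obtain ⟨F, hF⟩ := isCompact_univ.exists_bound_of_continuousOn hf.continuousOn
    exact ⟨F, (norm_nonneg _).trans (hF (Classical.arbitrary M) trivial), fun x => hF x trivial⟩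
  obtain ⟨P, hP, hφP⟩ : ∃ P, 0 ≤ P ∧ ∀ x, |φ x| ≤ P := by
    obtain ⟨P, hP⟩ := isCompact_univ.exists_bound_of_continuousOn hφ.continuousOn
    exact ⟨P, (norm_nonneg _).trans (hP (Classical.arbitrary M) trivial), fun x => hP x trivial⟩
  set D : M → ℝ := fun x => ∫ y, k x y ∂V
  have hDm : Measurable D := hkc.stronglyMeasurable.integral_prod_right.measurable
  have hDκ : ∀ x, κ ≤ D x := fun x => by
    have hint : Integrable (k x) V :=
      Integrable.of_bound (hkc.uncurry_left x).aestronglyMeasurable 1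
        (Filter.Eventually.of_forall fun y => hkabs x y)
    have := integral_mono (integrable_const κ) hint (fun y => hκk x y)
    simpa using this
  set h : M → M → ℝ := fun x z => k x z * (1 / (2 * D x) + 1 / (2 * D z)) * f z with hh
  have hhm : Measurable (Function.uncurry h) := by
    have h1 : Measurable fun p : M × M => D p.1 := hDm.comp measurable_fst
    have h2 : Measurable fun p : M × M => D p.2 := hDm.comp measurable_snd
    have h3 : Measurable fun p : M × M => f p.2 := hf.measurable.comp measurable_snd
    exact (hkc.measurable.mul (((h1.const_mul 2).const_div 1).add
      ((h2.const_mul 2).const_div 1))).mul h3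
  have hhB : ∀ x z, |h x z| ≤ F / κ := fun x z => by
    have hinv : ∀ x, |1 / (2 * D x)| ≤ 1 / (2 * κ) := fun x => by
      have := hκ.trans_le (hDκ x)
      rw [abs_of_pos (by positivity)]
      have := hDκ x
      gcongr
    rw [hh]
    simp only [abs_mul]
    calc _ ≤ 1 * (1 / (2 * κ) + 1 / (2 * κ)) * F := by
          gcongr
          · exact hkabs x z
          · exact (abs_add_le _ _).trans (add_le_add (hinv x) (hinv z))
          · exact hfF z
      _ = _ := by field_simp; ring
  set H : M → ℝ := fun x => ∫ z, h x z ∂V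
  have hHm : Measurable H := hhm.stronglyMeasurable.integral_prod_right.measurable
  have hHB : ∀ x, |H x| ≤ F / κ := fun x => by
    have := norm_integral_le_of_norm_le_const (μ := V) (f := h x) (C := F / κ)
      (Filter.Eventually.of_forall fun z => hhB x z)
    simpa using this
  set q : M → M → ℝ := fun _ z => (f z - H z) * φ z with hq
  have hqm : Measurable (Function.uncurry q) :=
    ((hf.measurable.sub hHm).mul hφ.measurable).comp measurable_snd
  have hqB : ∀ x z, |q x z| ≤ (F + F / κ) * P := fun x z => by
    rw [hq]
    simp only [abs_mul]
    gcongr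
    · exact (abs_sub _ _).trans (add_le_add (hfF z) (hHB z))
    · exact hφP z
  set B : ℝ := 1 + F / κ + (F + F / κ) * P
  have hFκ : 0 ≤ F / κ := by positivity
  have hFP : 0 ≤ (F + F / κ) * P := by positivity
  have hBpos : 0 < B := by positivity
  set c : ℝ := 2 / (m₂ * ε)
  have hcpos : 0 < c := by positivity
  have hlim : ∫ y, (c * (f y - ∫ z, khat y z * f z ∂V)) * φ y ∂V
      = c * ∫ y, (f y - H y) * φ y ∂V := by
    rw [← integral_const_mul]
    congr 1
    ext y
    have : ∫ z, khat y z * f z ∂V = H y := by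
      refine integral_congr_ae (Filter.Eventually.of_forall fun z => ?_)
      have hy := (hκ.trans_le (hDκ y)).ne'
      have hz := (hκ.trans_le (hDκ z)).ne'
      have hε' : ε ^ (-(d : ℝ) / 2) ≠ 0 := (rpow_pos_of_pos hε _).ne'
      simp only [hh, hkhat, hdeg]
      change _ * _ * (1 / (2 * (_ * D y)) + 1 / (2 * (_ * D z))) * _ = _
      field_simp
    rw [this]; ring
  set A : ℝ := F / κ ^ 2 * P + P + 1
  have hA : 0 < A := by positivity
  refine ⟨c * (A * (5 * B)) * ε ^ ((d : ℝ) / 2 + 1), by positivity, 3, fun n hn => ?_⟩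
  have hn3 : (3 : ℝ) ≤ n := by exact_mod_cast hn
  have hn0 : (0 : ℝ) < n := by linarith
  have hlog : 1 ≤ log n := by
    rw [le_log_iff_exp_le hn0]
    have := exp_one_lt_d9
    linarith
  have hrate : √(log n / n) ≤ log n ^ ((3 : ℝ) / 2) / √n := by
    rw [sqrt_div (by linarith), sqrt_eq_rpow (log n)]
    exact div_le_div_of_nonneg_right (rpow_le_rpow_of_exponent_le hlog (by norm_num)) (sqrt_nonneg _)
  set δ : ℝ := 5 * B * √(log n / n) with hδ
  set bad : (M → M → ℝ) → Set (Fin n → M) := fun g =>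
    {ω | ∃ i, δ < |1 / (n : ℝ) * ∑ a, g (ω i) (ω a) - ∫ z, g (ω i) z ∂V|} with hbad
  have hbadk : (Measure.pi fun _ : Fin n => V) (bad k) ≤ ENNReal.ofReal (2 / (n : ℝ) ^ 2) :=
    measure_pi_exists_lt_abs_mean_sub_integral_le V hkc.measurable hBpos
      (fun x y => (hkabs x y).trans (by linarith)) hn
  have hbadh : (Measure.pi fun _ : Fin n => V) (bad h) ≤ ENNReal.ofReal (2 / (n : ℝ) ^ 2) :=
    measure_pi_exists_lt_abs_mean_sub_integral_le V hhm hBpos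
      (fun x y => (hhB x y).trans (by linarith)) hn
  have hbadq : (Measure.pi fun _ : Fin n => V) (bad q) ≤ ENNReal.ofReal (2 / (n : ℝ) ^ 2) :=
    measure_pi_exists_lt_abs_mean_sub_integral_le V hqm hBpos
      (fun x y => (hqB x y).trans (by linarith)) hn
  have hbad_union : (Measure.pi fun _ : Fin n => V) (bad k ∪ bad h ∪ bad q)
      ≤ ENNReal.ofReal (6 / (n : ℝ) ^ 2) := by
    refine (measure_union_le _ _).trans ((add_le_add ((measure_union_le _ _).trans
      (add_le_add hbadk hbadh)) hbadq).trans_eq ?_)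
    rw [← ENNReal.ofReal_add (by positivity) (by positivity),
      ← ENNReal.ofReal_add (by positivity) (by positivity)]
    congr 1
    ring
  rw [ENNReal.ofReal_sub _ (by positivity), ENNReal.ofReal_one, tsub_le_iff_right]
  refine le_trans ?_ (add_le_add_right hbad_union _)
  rw [← measure_univ (μ := Measure.pi fun _ : Fin n => V)]
  refine (measure_mono fun ω _ => ?_).trans (measure_union_le _ _)
  by_cases hω : ω ∈ bad k ∪ bad h ∪ bad q
  · exact Or.inr hω
  left
  simp only [hbad, Set.mem_union, Set.mem_ofPred_eq, not_or, not_exists, not_lt] at hω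
  obtain ⟨⟨hωk, hωh⟩, hωq⟩ := hω
  have hform := abs_laplacianForm_sub_le (K := fun i j => k (ω i) (ω j)) (f := fun i => f (ω i))
    (φ := fun i => φ (ω i)) (dn := fun i => 1 / (n : ℝ) * ∑ a, k (ω i) (ω a))
    (D := fun i => D (ω i)) (H := fun i => H (ω i)) (I := ∫ y, (f y - H y) * φ y ∂V)
    hF hP hκ (by positivity : 0 ≤ δ) (fun _ _ => hkabs _ _) (fun _ => hfF _) (fun _ => hφP _)
    (fun i => by
      rw [one_div, le_inv_mul_iff₀ hn0]
      calc (n : ℝ) * κ = ∑ _a : Fin n, κ := by simp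
        _ ≤ _ := Finset.sum_le_sum fun a _ => hκk _ _)
    (fun _ => hDκ _) hωk hωh (hωq ⟨0, by omega⟩)
  simp only [Set.mem_ofPred_eq]
  rw [hlim]
  have htwo : ∀ x : ℝ, 2 / (n : ℝ) * x = 2 * (1 / (n : ℝ) * x) := fun x => by ring
  simp only [htwo, mul_assoc c]
  rw [← Finset.mul_sum, mul_left_comm, ← mul_sub, abs_mul, abs_of_pos hcpos]
  calc _ ≤ c * (A * δ) := mul_le_mul_of_nonneg_left hform hcpos.le
    _ = c * (A * (5 * B)) * √(log n / n) := by rw [hδ]; ring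
    _ ≤ c * (A * (5 * B)) * (log n ^ ((3 : ℝ) / 2) / √n) := by gcongr
    _ = _ := by
      have : ε ^ ((d : ℝ) / 2 + 1) ≠ 0 := (rpow_pos_of_pos hε _).ne'
      field_simp
end

section
/- Let f, φ : M → ℝ be continuous. Define the integral operator L_{q,ε} f := (2/(m₂ ε)) ( f − ∫_M k̂(·,y) f(y) dV(y) ) on L²(V), and the n×n matrix L_{q,ε,n} acting by (L_{q,ε,n} u)(x_i) := (2/(m₂ ε)) ( u(x_i) − (1/n) Σ_{j=1}^n k̂(x_i,x_j) u(x_j)/q(x_j) ). Then there exist a constant C > 0 and N ∈ ℕ such that for all n ≥ N, with probability at least 1 − 2/n² over the i.i.d. sample x₁,…,xₙ drawn from dμ = q dV, |⟨L_{q,ε,n} R_n f, R_n φ⟩_{L²(ν_n)} − ∫_M (L_{q,ε} f)(y) φ(y) dV(y)| ≤ C (log n)^{3/2} / (ε^{d/2+1} √n). -/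
open MeasureTheory Real

open ProbabilityTheory
open scoped NNReal

/-- **McDiarmid's inequality**, in moment generating function form: a bounded function of
independent variables with bounded differences is sub-Gaussian around its mean. -/
theorem hasSubgaussianMGF_of_bounded_differences {X : Type*} [MeasurableSpace X]
    (μ : Measure X) [IsProbabilityMeasure μ] {n : ℕ} (F : (Fin n → X) → ℝ) (hF : Measurable F)
    {K : ℝ} (hK : ∀ ω, |F ω| ≤ K) (c : Fin n → ℝ≥0)
    (hc : ∀ i ω x, |F (Function.update ω i x) - F ω| ≤ c i) :
    HasSubgaussianMGF (fun ω ↦ F ω - ∫ ω', F ω' ∂(Measure.pi fun _ : Fin n ↦ μ))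
      (∑ i, (c i / 2) ^ 2) (Measure.pi fun _ : Fin n ↦ μ) := by
  have : Nonempty X := nonempty_of_isProbabilityMeasure μ
  induction n with
  | zero =>
    have h : ∀ ω, F ω - ∫ ω', F ω' ∂(Measure.pi fun _ : Fin 0 ↦ μ) = 0 := by
      intro ω
      rw [integral_congr_ae (ae_of_all _ fun ω' ↦ congrArg F (Subsingleton.elim ω' ω))]
      simp
    simp_rw [h]
    simp
  | succ n ih =>
    let P : Measure (Fin n → X) := Measure.pi fun _ ↦ μ
    let e := MeasurableEquiv.piFinSuccAbove (fun _ : Fin (n + 1) ↦ X) 0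
    have he : MeasurePreserving e.symm (μ.prod P) (Measure.pi fun _ ↦ μ) :=
      (measurePreserving_piFinSuccAbove (fun _ : Fin (n + 1) ↦ μ) 0).symm
    have he_apply : ∀ p, e.symm p = Fin.cons p.1 p.2 := by
      intro p
      simp [e, MeasurableEquiv.piFinSuccAbove_symm_apply]
      rfl
    let F' : X × (Fin n → X) → ℝ := fun p ↦ F (e.symm p)
    have hF' : Measurable F' := hF.comp e.symm.measurable
    have hF'K : ∀ p, |F' p| ≤ K := fun p ↦ hK _
    have hint : ∀ y, Integrable (fun x ↦ F' (x, y)) μ := fun y ↦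
      Integrable.of_bound (hF'.comp measurable_prodMk_right).aestronglyMeasurable K
        (ae_of_all _ fun x ↦ hF'K _)
    let G : (Fin n → X) → ℝ := fun y ↦ ∫ x, F' (x, y) ∂μ
    have hG : Measurable G := (hF'.stronglyMeasurable.integral_prod_left').measurable
    have hGK : ∀ y, |G y| ≤ K := by
      intro y
      simpa using norm_integral_le_of_norm_le_const (μ := μ) (f := fun x ↦ F' (x, y))
        (ae_of_all _ fun x ↦ hF'K (x, y))
    have hGc : ∀ i y x, |G (Function.update y i x) - G y| ≤ c i.succ := by
      intro i y x
      simp only [G]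
      rw [← integral_sub (hint _) (hint _)]
      have := norm_integral_le_of_norm_le_const (μ := μ) (C := c i.succ)
        (f := fun z ↦ F' (z, Function.update y i x) - F' (z, y)) (ae_of_all _ fun z ↦ by
          simp only [F', he_apply, Fin.cons_update]
          exact hc _ _ _)
      simpa using this
    have hEG : ∫ ω, F ω ∂(Measure.pi fun _ : Fin (n + 1) ↦ μ) = ∫ y, G y ∂P := by
      rw [← he.integral_comp', integral_prod_symm]
      exact Integrable.of_bound hF'.aestronglyMeasurable K (ae_of_all _ hF'K)
    have ihG := ih G hG hGK (fun i ↦ c i.succ) hGc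
    have hfiber : ∀ y, HasSubgaussianMGF (fun x ↦ F' (x, y) - G y) ((c 0 / 2) ^ 2) μ := by
      intro y
      have hbdd : BddBelow (Set.range fun x ↦ F' (x, y)) :=
        ⟨-K, by rintro _ ⟨x, rfl⟩; exact (abs_le.1 (hF'K _)).1⟩
      have := hasSubgaussianMGF_of_mem_Icc (μ := μ) (X := fun x ↦ F' (x, y))
        (a := ⨅ x, F' (x, y)) (b := (⨅ x, F' (x, y)) + c 0)
        (hF'.comp measurable_prodMk_right).aemeasurable
        (ae_of_all _ fun x ↦ ⟨ciInf_le hbdd x, by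
          rw [← sub_le_iff_le_add]
          refine le_ciInf fun z ↦ ?_
          have h := hc 0 (Fin.cons z y) x
          rw [Fin.update_cons_zero] at h
          simp only [F', he_apply]
          linarith [(abs_le.1 h).2]⟩)
      simpa [G] using this
    set E := ∫ y, G y ∂P
    have hexp : ∀ t : ℝ, Integrable (fun p ↦ exp (t * (F' p - E))) (μ.prod P) := by
      intro t
      refine Integrable.of_bound (by fun_prop) (exp (|t| * (K + |E|))) (ae_of_all _ fun p ↦ ?_)
      rw [Real.norm_eq_abs, abs_exp, exp_le_exp]
      refine (le_abs_self _).trans ?_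
      rw [abs_mul]
      gcongr
      exact (abs_sub _ _).trans (by gcongr; exact hF'K p)
    rw [hEG]
    constructor
    · intro t
      rw [← he.integrable_comp_emb e.symm.measurableEmbedding]
      exact hexp t
    · intro t
      calc mgf (fun ω ↦ F ω - E) (Measure.pi fun _ ↦ μ) t
          = ∫ p, exp (t * (F' p - E)) ∂(μ.prod P) :=
            (he.integral_comp' (g := fun ω ↦ exp (t * (F ω - E)))).symm
        _ = ∫ y, ∫ x, exp (t * (F' (x, y) - E)) ∂μ ∂P := integral_prod_symm _ (hexp t)
        _ ≤ ∫ y, exp (t * (G y - E)) * exp (((c 0 / 2) ^ 2 : ℝ≥0) * t ^ 2 / 2) ∂P := by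
            refine integral_mono (hexp t).integral_prod_right
              ((ihG.integrable_exp_mul t).mul_const _) fun y ↦ ?_
            have h : ∀ x, exp (t * (F' (x, y) - E))
                = exp (t * (G y - E)) * exp (t * (F' (x, y) - G y)) := by
              intro x
              rw [← exp_add]
              ring_nf
            simp only [h]
            rw [integral_const_mul]
            gcongr
            exact (hfiber y).mgf_le t
        _ = mgf (fun y ↦ G y - E) P t * exp (((c 0 / 2) ^ 2 : ℝ≥0) * t ^ 2 / 2) := by
            rw [integral_mul_const]
            rfl
        _ ≤ exp ((∑ i : Fin n, (c i.succ / 2) ^ 2 : ℝ≥0) * t ^ 2 / 2)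
              * exp (((c 0 / 2) ^ 2 : ℝ≥0) * t ^ 2 / 2) := by
            gcongr
            exact ihG.mgf_le t
        _ = exp ((∑ i, (c i / 2) ^ 2 : ℝ≥0) * t ^ 2 / 2) := by
            rw [← exp_add, Fin.sum_univ_succ]
            push_cast
            ring_nf

section VStatistic

variable {X : Type*} {n : ℕ} {h : X × X → ℝ} {A : ℝ}

/-- The V-statistic of order two with kernel `h`. -/
noncomputable def vStatistic (h : X × X → ℝ) {n : ℕ} (ω : Fin n → X) : ℝ :=
  1 / (n : ℝ) ^ 2 * ∑ i, ∑ j, h (ω i, ω j)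

theorem abs_vStatistic_le (hn : 0 < n) (hA : ∀ p, |h p| ≤ A) (ω : Fin n → X) :
    |vStatistic h ω| ≤ A := by
  have hn' : (0 : ℝ) < n := by exact_mod_cast hn
  have hs : |∑ i, ∑ j, h (ω i, ω j)| ≤ ∑ _i : Fin n, ∑ _j : Fin n, A :=
    (Finset.abs_sum_le_sum_abs _ _).trans <| Finset.sum_le_sum fun i _ ↦
      (Finset.abs_sum_le_sum_abs _ _).trans <| Finset.sum_le_sum fun j _ ↦ hA _
  rw [vStatistic, abs_mul, abs_of_pos (by positivity), one_div_mul_eq_div, div_le_iff₀ (by positivity)]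
  refine hs.trans (le_of_eq ?_)
  simp
  ring

theorem abs_vStatistic_update_sub_le (hn : 0 < n) (hA : ∀ p, |h p| ≤ A) (i : Fin n)
    (ω : Fin n → X) (x : X) :
    |vStatistic h (Function.update ω i x) - vStatistic h ω| ≤ 4 * A / n := by
  have hn' : (0 : ℝ) < n := by exact_mod_cast hn
  have hA0 : 0 ≤ A := (abs_nonneg _).trans (hA (x, x))
  have hterm : ∀ a b, |h (Function.update ω i x a, Function.update ω i x b) - h (ω a, ω b)|
      ≤ (if a = i then 2 * A else 0) + if b = i then 2 * A else 0 := by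
    intro a b
    have h2 := (abs_sub (h (Function.update ω i x a, Function.update ω i x b)) (h (ω a, ω b))).trans
      (add_le_add (hA _) (hA _))
    by_cases ha : a = i
    · rw [if_pos ha]
      split_ifs <;> linarith
    · by_cases hb : b = i
      · rw [if_pos hb, if_neg ha]
        linarith
      · simp [ha, hb]
  have hs : |∑ a, ∑ b, (h (Function.update ω i x a, Function.update ω i x b) - h (ω a, ω b))|
      ≤ ∑ a : Fin n, ∑ b : Fin n, ((if a = i then 2 * A else 0) + if b = i then 2 * A else 0) :=
    (Finset.abs_sum_le_sum_abs _ _).trans <| Finset.sum_le_sum fun a _ ↦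
      (Finset.abs_sum_le_sum_abs _ _).trans <| Finset.sum_le_sum fun b _ ↦ hterm a b
  have hs' : ∑ a : Fin n, ∑ b : Fin n, ((if a = i then 2 * A else 0) + if b = i then 2 * A else 0)
      = 4 * A * n := by
    simp [Finset.sum_add_distrib]
    ring
  rw [vStatistic, vStatistic, ← mul_sub, ← Finset.sum_sub_distrib]
  simp_rw [← Finset.sum_sub_distrib]
  rw [abs_mul, abs_of_pos (by positivity), one_div_mul_eq_div, div_le_iff₀ (by positivity)]
  calc _ ≤ 4 * A * n := hs.trans hs'.le
    _ = _ := by field_simp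

variable [MeasurableSpace X]

theorem measurable_vStatistic (hh : Measurable h) :
    Measurable (vStatistic h : (Fin n → X) → ℝ) := by
  unfold vStatistic
  fun_prop

theorem integral_pair_pi (μ : Measure X) [IsProbabilityMeasure μ] (hh : Measurable h)
    {i j : Fin n} (hij : i ≠ j) :
    ∫ ω, h (ω i, ω j) ∂(Measure.pi fun _ : Fin n ↦ μ) = ∫ p, h p ∂(μ.prod μ) := by
  have hind : IndepFun (fun ω : Fin n → X ↦ ω i) (fun ω ↦ ω j) (Measure.pi fun _ ↦ μ) :=
    (iIndepFun_pi (μ := fun _ : Fin n ↦ μ) (X := fun _ x ↦ x) fun _ ↦ aemeasurable_id).indepFun hij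
  have hmap := (indepFun_iff_map_prod_eq_prod_map_map (measurable_pi_apply i).aemeasurable
    (measurable_pi_apply j).aemeasurable).1 hind
  have h1 : ∀ k, (Measure.pi fun _ : Fin n ↦ μ).map (fun ω ↦ ω k) = μ :=
    fun k ↦ (measurePreserving_eval (fun _ : Fin n ↦ μ) k).map_eq
  rw [h1, h1] at hmap
  rw [← hmap, integral_map (by fun_prop) hh.aestronglyMeasurable]

theorem abs_integral_vStatistic_sub_le (μ : Measure X) [IsProbabilityMeasure μ] (hn : 0 < n)
    (hh : Measurable h) (hA : ∀ p, |h p| ≤ A) :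
    |∫ ω, vStatistic h ω ∂(Measure.pi fun _ : Fin n ↦ μ) - ∫ p, h p ∂(μ.prod μ)| ≤ 2 * A / n := by
  have hn' : (0 : ℝ) < n := by exact_mod_cast hn
  set P : Measure (Fin n → X) := Measure.pi fun _ ↦ μ
  set θ := ∫ p, h p ∂(μ.prod μ)
  have hint : ∀ i j, Integrable (fun ω : Fin n → X ↦ h (ω i, ω j)) P := fun i j ↦
    Integrable.of_bound (Measurable.aestronglyMeasurable (by fun_prop)) A (ae_of_all _ fun ω ↦ hA _)
  have hθ : |θ| ≤ A := by
    simpa using norm_integral_le_of_norm_le_const (μ := μ.prod μ) (f := h) (ae_of_all _ hA)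
  have hE : ∫ ω, vStatistic h ω ∂P = 1 / (n : ℝ) ^ 2 * ∑ i, ∑ j, ∫ ω, h (ω i, ω j) ∂P := by
    simp only [vStatistic]
    rw [integral_const_mul, integral_finsetSum _ fun i _ ↦ integrable_finsetSum _ fun j _ ↦ hint i j]
    simp_rw [integral_finsetSum _ fun j _ ↦ hint _ j]
  have hsub : ∫ ω, vStatistic h ω ∂P - θ
      = 1 / (n : ℝ) ^ 2 * ∑ i, ∑ j, (∫ ω, h (ω i, ω j) ∂P - θ) := by
    rw [hE]
    simp [Finset.sum_sub_distrib]
    field_simp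
  have hterm : ∀ i j, |∫ ω, h (ω i, ω j) ∂P - θ| ≤ if j = i then 2 * A else 0 := by
    intro i j
    split_ifs with hij
    · have : |∫ ω, h (ω i, ω j) ∂P| ≤ A := by
        simpa using norm_integral_le_of_norm_le_const (μ := P)
          (f := fun ω ↦ h (ω i, ω j)) (ae_of_all _ fun ω ↦ hA _)
      linarith [abs_sub (∫ ω, h (ω i, ω j) ∂P) θ]
    · simp [P, θ, integral_pair_pi μ hh (Ne.symm hij)]
  have hs : |∑ i, ∑ j, (∫ ω, h (ω i, ω j) ∂P - θ)| ≤ ∑ i : Fin n, ∑ j, if j = i then 2 * A else 0 :=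
    (Finset.abs_sum_le_sum_abs _ _).trans <| Finset.sum_le_sum fun i _ ↦
      (Finset.abs_sum_le_sum_abs _ _).trans <| Finset.sum_le_sum fun j _ ↦ hterm i j
  rw [hsub, abs_mul, abs_of_pos (by positivity), one_div_mul_eq_div, div_le_iff₀ (by positivity)]
  refine hs.trans (le_of_eq ?_)
  simp
  field_simp

/-- Concentration of a bounded second-order V-statistic around its limit. -/
theorem ofReal_le_measure_abs_vStatistic_sub_le (μ : Measure X) [IsProbabilityMeasure μ]
    (hn : 3 ≤ n) (hh : Measurable h) (hApos : 0 < A) (hA : ∀ p, |h p| ≤ A) :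
    ENNReal.ofReal (1 - 2 / (n : ℝ) ^ 2) ≤ (Measure.pi fun _ : Fin n ↦ μ)
      {ω | |vStatistic h ω - ∫ p, h p ∂(μ.prod μ)| ≤ 6 * A * √(log n / n)} := by
  have hn0 : 0 < n := by omega
  have hn3 : (3 : ℝ) ≤ n := by exact_mod_cast hn
  have hn' : (0 : ℝ) < n := by linarith
  have hlog : 1 ≤ log n := by
    rw [le_log_iff_exp_le hn']
    linarith [exp_one_lt_d9]
  set P : Measure (Fin n → X) := Measure.pi fun _ ↦ μ
  set s := √(log n / n)
  have hs2 : s ^ 2 = log n / n := sq_sqrt (by positivity)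
  have hs0 : 0 ≤ s := sqrt_nonneg _
  have hns : 1 / (n : ℝ) ≤ s := by
    apply le_sqrt_of_sq_le
    rw [div_pow, one_pow, div_le_div_iff₀ (by positivity) hn']
    nlinarith
  set E := ∫ ω, vStatistic h ω ∂P
  have hbias : |E - ∫ p, h p ∂(μ.prod μ)| ≤ 2 * A * s := by
    refine (abs_integral_vStatistic_sub_le μ hn0 hh hA).trans ?_
    rw [mul_div_assoc, mul_assoc, div_eq_mul_one_div]
    gcongr
  let c : ℝ≥0 := ⟨4 * A / n, by positivity⟩
  have hsub := hasSubgaussianMGF_of_bounded_differences μ (vStatistic h : (Fin n → X) → ℝ)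
    (measurable_vStatistic hh) (abs_vStatistic_le hn0 hA) (fun _ ↦ c)
    (fun i ω x ↦ abs_vStatistic_update_sub_le hn0 hA i ω x)
  have hexp : exp (-(4 * A * s) ^ 2 / (2 * (∑ _i : Fin n, (c / 2) ^ 2 : ℝ≥0))) = 1 / (n : ℝ) ^ 2 := by
    have hc : (c : ℝ) = 4 * A / n := rfl
    have : -(4 * A * s) ^ 2 / (2 * ((∑ _i : Fin n, (c / 2) ^ 2 : ℝ≥0) : ℝ)) = -(2 * log n) := by
      push_cast
      rw [hc, mul_pow, hs2]
      simp
      field_simp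
    rw [this, exp_neg, two_mul, exp_add, exp_log hn']
    field_simp
  have hup : P.real {ω | 4 * A * s ≤ vStatistic h ω - E} ≤ 1 / (n : ℝ) ^ 2 :=
    hexp ▸ hsub.measure_ge_le (by positivity)
  have hlo : P.real {ω | 4 * A * s ≤ -(vStatistic h ω - E)} ≤ 1 / (n : ℝ) ^ 2 :=
    hexp ▸ hsub.neg.measure_ge_le (by positivity)
  set S := {ω : Fin n → X | |vStatistic h ω - ∫ p, h p ∂(μ.prod μ)| ≤ 6 * A * s}
  have hS : MeasurableSet S :=
    measurableSet_le ((measurable_vStatistic hh).sub_const _).abs measurable_const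
  have hcompl : Sᶜ ⊆ {ω | 4 * A * s ≤ vStatistic h ω - E}
      ∪ {ω | 4 * A * s ≤ -(vStatistic h ω - E)} := by
    intro ω hω
    rw [Set.mem_union, Set.mem_ofPred_eq, Set.mem_ofPred_eq, ← le_abs]
    simp only [S, Set.mem_compl_iff, Set.mem_ofPred_eq, not_le] at hω
    linarith [abs_sub_le (vStatistic h ω) E (∫ p, h p ∂(μ.prod μ))]
  have hle : P.real Sᶜ ≤ 2 / (n : ℝ) ^ 2 :=
    calc P.real Sᶜ ≤ _ := (measureReal_mono hcompl).trans (measureReal_union_le _ _)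
      _ ≤ 1 / (n : ℝ) ^ 2 + 1 / (n : ℝ) ^ 2 := add_le_add hup hlo
      _ = _ := by ring
  rw [probReal_compl_eq_one_sub hS] at hle
  exact (ENNReal.ofReal_le_iff_le_toReal (measure_ne_top _ _)).2 (by
    change _ ≤ P.real S
    linarith)

end VStatistic

theorem integral_div_withDensity_ofReal {X : Type*} [MeasurableSpace X] (V : Measure X)
    {q : X → ℝ} (hq : Measurable q) (hpos : ∀ x, 0 < q x) (g : X → ℝ) :
    ∫ x, g x / q x ∂(V.withDensity fun x ↦ ENNReal.ofReal (q x)) = ∫ x, g x ∂V := by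
  rw [integral_withDensity_eq_integral_toReal_smul hq.ennreal_ofReal (by simp)]
  refine integral_congr_ae (ae_of_all _ fun x ↦ ?_)
  have := (hpos x).ne'
  simp only [ENNReal.toReal_ofReal (hpos x).le, smul_eq_mul]
  field_simp

theorem statement_11
    {m d : ℕ} (hd : 1 ≤ d)
    (M : Set (EuclideanSpace ℝ (Fin m))) (hMcomp : IsCompact M)
    (V : Measure M) [IsFiniteMeasure V]
    -- the sampling density q with dμ = q dV a probability measure
    (q : M → ℝ) (hqcont : Continuous q) (hqpos : ∀ x, 0 < q x)
    (hq1 : ∫ x, q x ∂V = 1)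
    (qmin : ℝ) (hqmin : qmin = ⨅ x : M, q x) (hqminpos : 0 < qmin)
    (μ : Measure M) [IsProbabilityMeasure μ]
    (hμ : μ = V.withDensity fun x => ENNReal.ofReal (q x))
    (ε m₂ B : ℝ) (hε : 0 < ε) (hm₂ : 0 < m₂) (hB : 0 < B)
    -- a continuous symmetric kernel with 0 ≤ k̂ ≤ B ε^{-d/2}
    (khat : M → M → ℝ) (hkcont : Continuous fun p : M × M => khat p.1 p.2)
    (hksymm : ∀ x y, khat x y = khat y x)
    (hkbound : ∀ x y, 0 ≤ khat x y ∧ khat x y ≤ B * ε ^ (-(d : ℝ) / 2))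
    (f φ : M → ℝ) (hf : Continuous f) (hφ : Continuous φ) :
    ∃ C : ℝ, 0 < C ∧ ∃ N : ℕ, ∀ n : ℕ, N ≤ n →
      ENNReal.ofReal (1 - 2 / (n : ℝ) ^ 2) ≤
        (Measure.pi fun _ : Fin n => μ)
          {ω : Fin n → M |
            |(1 / (n : ℝ)) * ∑ i : Fin n,
                ((2 / (m₂ * ε)) * (f (ω i) - (1 / (n : ℝ)) *
                    ∑ j : Fin n, khat (ω i) (ω j) * f (ω j) / q (ω j)))
                  * φ (ω i) / q (ω i)
              - ∫ y, ((2 / (m₂ * ε)) * (f y - ∫ z, khat y z * f z ∂V)) * φ y ∂V|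
              ≤ C * Real.log n ^ ((3 : ℝ) / 2) / (ε ^ ((d : ℝ) / 2 + 1) * Real.sqrt n)} := by
  have : CompactSpace M := isCompact_iff_compactSpace.1 hMcomp
  have hq0 : ∀ x, q x ≠ 0 := fun x ↦ (hqpos x).ne'
  set κ := 2 / (m₂ * ε)
  let h : M × M → ℝ := fun p ↦
    κ * (f p.1 - khat p.1 p.2 * f p.2 / q p.2) * φ p.1 / q p.1
  have hcont : Continuous h := by
    have hq1' : ∀ p : M × M, q p.1 ≠ 0 := fun p ↦ hq0 _
    have hq2' : ∀ p : M × M, q p.2 ≠ 0 := fun p ↦ hq0 _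
    fun_prop (disch := assumption)
  obtain ⟨A, hApos, hA⟩ : ∃ A : ℝ, 0 < A ∧ ∀ p, |h p| ≤ A := by
    obtain ⟨A, hA⟩ := isCompact_univ.exists_bound_of_continuousOn hcont.continuousOn
    exact ⟨max A 1, by positivity, fun p ↦ (hA p (Set.mem_univ p)).trans (le_max_left _ _)⟩
  have hlim : ∫ p, h p ∂(μ.prod μ) = ∫ y, (κ * (f y - ∫ z, khat y z * f z ∂V)) * φ y ∂V := by
    rw [integral_prod _ (Integrable.of_bound hcont.aestronglyMeasurable A (ae_of_all _ hA)),
      ← integral_div_withDensity_ofReal V hqcont.measurable hqpos, ← hμ]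
    refine integral_congr_ae (ae_of_all _ fun x ↦ ?_)
    have hkint : Integrable (fun y ↦ khat x y * f y / q y) μ := by
      have hc : Continuous fun y ↦ khat x y * f y / q y :=
        ((hkcont.comp (Continuous.prodMk_right x)).mul hf).div hqcont hq0
      obtain ⟨K, hK⟩ := isCompact_univ.exists_bound_of_continuousOn hc.continuousOn
      exact Integrable.of_bound hc.aestronglyMeasurable K (ae_of_all _ fun y ↦ hK y (Set.mem_univ y))
    have hk : ∫ y, khat x y * f y / q y ∂μ = ∫ z, khat x z * f z ∂V := by
      rw [hμ]
      exact integral_div_withDensity_ofReal V hqcont.measurable hqpos _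
    simp only [h]
    rw [integral_div, integral_mul_const, integral_const_mul,
      integral_sub (integrable_const _) hkint, hk]
    simp
  have hstat : ∀ (n : ℕ) (ω : Fin n → M), 0 < n →
      (1 / (n : ℝ)) * ∑ i : Fin n, (κ * (f (ω i) - (1 / (n : ℝ)) *
        ∑ j : Fin n, khat (ω i) (ω j) * f (ω j) / q (ω j))) * φ (ω i) / q (ω i)
      = vStatistic h ω := by
    intro n ω hn
    have hn' : (n : ℝ) ≠ 0 := by exact_mod_cast hn.ne'
    rw [vStatistic, sq, ← one_div_mul_one_div, mul_assoc]
    congr 1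
    rw [Finset.mul_sum]
    refine Finset.sum_congr rfl fun i _ ↦ ?_
    simp only [h]
    rw [← Finset.sum_div, ← Finset.sum_mul, ← Finset.mul_sum, Finset.sum_sub_distrib]
    simp
    field_simp
  have hεd : 0 < ε ^ ((d : ℝ) / 2 + 1) := rpow_pos_of_pos hε _
  refine ⟨6 * A * ε ^ ((d : ℝ) / 2 + 1), by positivity, 3, fun n hn ↦ ?_⟩
  refine (ofReal_le_measure_abs_vStatistic_sub_le μ hn hcont.measurable hApos hA).trans
    (measure_mono fun ω hω ↦ ?_)
  simp only [Set.mem_ofPred_eq] at hω ⊢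
  rw [hstat n ω (by omega), ← hlim]
  refine hω.trans ?_
  have hn3 : (3 : ℝ) ≤ n := by exact_mod_cast hn
  have hlog : 1 ≤ log n := by
    rw [le_log_iff_exp_le (by linarith)]
    linarith [exp_one_lt_d9]
  have hpow : √(log n) ≤ log n ^ ((3 : ℝ) / 2) := by
    rw [sqrt_eq_rpow]
    exact rpow_le_rpow_of_exponent_le hlog (by norm_num)
  have hcancel : 6 * A * ε ^ ((d : ℝ) / 2 + 1) * log n ^ ((3 : ℝ) / 2)
      / (ε ^ ((d : ℝ) / 2 + 1) * √n) = 6 * A * (log n ^ ((3 : ℝ) / 2) / √n) := by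
    field_simp
  rw [hcancel, sqrt_div (by linarith)]
  gcongr
end

section
/- Let f₁, …, f_k : M → ℝ be bounded measurable functions that are orthonormal in L²(μ), and set C_l := max_{1≤j≤k} sup_{x∈M} |f_j(x)|. Then for every n ≥ 2, with probability at least 1 − 2k²/n² over the i.i.d. sample x₁,…,xₙ drawn from μ, max_{1≤i,j≤k} | ⟨R_n f_i, R_n f_j⟩_{L²(μ_n)} − δ_{ij} | ≤ 2 C_l² √(log n)/√n. -/
open MeasureTheory Real

/-- Two-sided Chernoff bound for a sub-Gaussian random variable. -/
theorem ProbabilityTheory.HasSubgaussianMGF.measureReal_lt_abs_le {Ω : Type*}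
    [MeasurableSpace Ω] {P : Measure Ω} [IsFiniteMeasure P] {X : Ω → ℝ} {c : NNReal}
    (h : HasSubgaussianMGF X c P) {ε : ℝ} (hε : 0 ≤ ε) :
    P.real {ω | ε < |X ω|} ≤ 2 * exp (-ε ^ 2 / (2 * c)) := by
  have hsub : {ω | ε < |X ω|} ⊆ {ω | ε ≤ X ω} ∪ {ω | ε ≤ (-X) ω} := by
    intro ω hω
    have hlt : ε < |X ω| := hω
    rcases lt_abs.1 hlt with h | h
    · exact Or.inl h.le
    · exact Or.inr (show ε ≤ -X ω from h.le)
  calc P.real {ω | ε < |X ω|}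
      ≤ P.real ({ω | ε ≤ X ω} ∪ {ω | ε ≤ (-X) ω}) := measureReal_mono hsub
    _ ≤ P.real {ω | ε ≤ X ω} + P.real {ω | ε ≤ (-X) ω} := measureReal_union_le _ _
    _ ≤ 2 * exp (-ε ^ 2 / (2 * c)) := by
      linarith [h.measure_ge_le hε, h.neg.measure_ge_le hε]

open ProbabilityTheory in
/-- The centred sum of a bounded function over an i.i.d. sample is sub-Gaussian. -/
theorem hasSubgaussianMGF_sum_sub_integral {M : Type*} [MeasurableSpace M] (μ : Measure M)
    [IsProbabilityMeasure μ] {g : M → ℝ} (hg : Measurable g) {B : NNReal}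
    (hB : ∀ x, |g x| ≤ B) (n : ℕ) :
    HasSubgaussianMGF (fun ω : Fin n → M => ∑ a, (g (ω a) - ∫ x, g x ∂μ)) (n * B ^ 2)
      (Measure.pi fun _ => μ) := by
  have hc : HasSubgaussianMGF (fun x => g x - ∫ y, g y ∂μ) (B ^ 2) μ := by
    have h := hasSubgaussianMGF_of_mem_Icc (μ := μ) (a := -(B : ℝ)) (b := B) hg.aemeasurable
      (ae_of_all _ fun x => Set.mem_Icc.2 (abs_le.1 (hB x)))
    convert h using 2
    ext
    simp [← two_mul]
  have hind : iIndepFun (fun (a : Fin n) (ω : Fin n → M) => g (ω a) - ∫ x, g x ∂μ)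
      (Measure.pi fun _ => μ) :=
    iIndepFun_pi (X := fun _ x => g x - ∫ y, g y ∂μ) fun _ => (hg.sub_const _).aemeasurable
  have hsum := HasSubgaussianMGF.sum_of_iIndepFun hind (c := fun _ => B ^ 2) (s := Finset.univ)
    fun a _ => HasSubgaussianMGF.of_map (Y := fun ω : Fin n → M => ω a)
      (X := fun x => g x - ∫ y, g y ∂μ) (measurable_pi_apply a).aemeasurable
      (by rwa [(measurePreserving_eval (fun _ : Fin n => μ) a).map_eq])
  simpa using hsum

/-- Hoeffding's inequality for the empirical mean of a function bounded by `B`, at the deviation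
`2 B √(log n) / √n`. -/
theorem measureReal_empirical_deviation_le {M : Type*} [MeasurableSpace M] (μ : Measure M)
    [IsProbabilityMeasure μ] {g : M → ℝ} (hg : Measurable g) {B : ℝ} (hBpos : 0 < B)
    (hB : ∀ x, |g x| ≤ B) {n : ℕ} (hn : 0 < n) :
    (Measure.pi fun _ : Fin n => μ).real
      {ω | 2 * B * √(log n) / √n < |(1 / (n : ℝ)) * ∑ a, g (ω a) - ∫ x, g x ∂μ|}
      ≤ 2 / (n : ℝ) ^ 2 := by
  lift B to NNReal using hBpos.le
  have hn' : (0 : ℝ) < n := by exact_mod_cast hn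
  have hlog : 0 ≤ log n := log_natCast_nonneg n
  have hε : 0 ≤ n * (2 * B * √(log n) / √n) := by positivity
  have key := (hasSubgaussianMGF_sum_sub_integral μ hg hB n).measureReal_lt_abs_le hε
  have hexp : exp (-(n * (2 * B * √(log n) / √n)) ^ 2 / (2 * ((n * B ^ 2 : NNReal) : ℝ)))
      = 1 / (n : ℝ) ^ 2 := by
    have : -(n * (2 * B * √(log n) / √n)) ^ 2 / (2 * ((n * B ^ 2 : NNReal) : ℝ))
        = -(log n + log n) := by
      push_cast
      rw [mul_pow, div_pow, mul_pow, sq_sqrt hlog, sq_sqrt hn'.le]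
      field_simp
      ring
    rw [this, exp_neg, exp_add, exp_log hn']
    field_simp
  rw [hexp, mul_one_div] at key
  convert key using 3
  ext ω
  have : ∑ a, (g (ω a) - ∫ x, g x ∂μ)
      = n * ((1 / (n : ℝ)) * ∑ a, g (ω a) - ∫ x, g x ∂μ) := by
    rw [Finset.sum_sub_distrib]
    simp
    field_simp
  rw [this, abs_mul, abs_of_pos hn', mul_lt_mul_iff_right₀ hn']

open MeasureTheory Real

theorem statement_15
    {M : Type*} [MetricSpace M] [CompactSpace M] [MeasurableSpace M] [BorelSpace M]
    (μ : Measure M) [IsProbabilityMeasure μ]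
    {k : ℕ} (f : Fin k → M → ℝ)
    (hmeas : ∀ j, Measurable (f j))
    (hbdd : ∀ j, ∃ B : ℝ, ∀ x, |f j x| ≤ B)
    -- orthonormality in L²(μ)
    (horth : ∀ i j, ∫ x, f i x * f j x ∂μ = if i = j then (1 : ℝ) else 0)
    (Cl : ℝ) (hCl : Cl = ⨆ j : Fin k, ⨆ x : M, |f j x|)
    (n : ℕ) (hn : 2 ≤ n) :
    ENNReal.ofReal (1 - 2 * (k : ℝ) ^ 2 / (n : ℝ) ^ 2) ≤
      (Measure.pi fun _ : Fin n => μ)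
        {ω : Fin n → M | ∀ i j : Fin k,
          |(1 / (n : ℝ)) * ∑ a : Fin n, f i (ω a) * f j (ω a)
              - if i = j then (1 : ℝ) else 0|
            ≤ 2 * Cl ^ 2 * Real.sqrt (Real.log n) / Real.sqrt n} := by
  have hbound : ∀ j x, |f j x| ≤ Cl := by
    intro j x
    obtain ⟨B, hB⟩ := hbdd j
    rw [hCl]
    exact (le_ciSup (f := fun x => |f j x|) ⟨B, by rintro _ ⟨x, rfl⟩; exact hB x⟩ x).trans
      (le_ciSup (f := fun j => ⨆ x, |f j x|) (Set.finite_range _).bddAbove j)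
  have hpos : Fin k → 0 < Cl := by
    intro j
    by_contra! h
    have hzero : ∀ x, f j x = 0 := fun x => abs_nonpos_iff.1 ((hbound j x).trans h)
    simpa [hzero] using horth j j
  set P := Measure.pi fun _ : Fin n => μ
  set S := {ω : Fin n → M | ∀ i j : Fin k,
    |(1 / (n : ℝ)) * ∑ a : Fin n, f i (ω a) * f j (ω a) - if i = j then (1 : ℝ) else 0|
      ≤ 2 * Cl ^ 2 * √(log n) / √n}
  have hpair : ∀ p : Fin k × Fin k, P.real {ω | 2 * Cl ^ 2 * √(log n) / √n <
      |(1 / (n : ℝ)) * ∑ a : Fin n, f p.1 (ω a) * f p.2 (ω a)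
        - if p.1 = p.2 then (1 : ℝ) else 0|} ≤ 2 / (n : ℝ) ^ 2 := by
    intro p
    rw [← horth p.1 p.2]
    refine measureReal_empirical_deviation_le μ ((hmeas p.1).mul (hmeas p.2))
      (pow_pos (hpos p.1) 2) (fun x => ?_) (by omega)
    rw [Pi.mul_apply, abs_mul, sq]
    exact mul_le_mul (hbound _ x) (hbound _ x) (abs_nonneg _) (hpos p.1).le
  have hcompl : P.real Sᶜ ≤ 2 * (k : ℝ) ^ 2 / (n : ℝ) ^ 2 := by
    calc P.real Sᶜ
        ≤ P.real (⋃ p : Fin k × Fin k, {ω | 2 * Cl ^ 2 * √(log n) / √n <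
            |(1 / (n : ℝ)) * ∑ a : Fin n, f p.1 (ω a) * f p.2 (ω a)
              - if p.1 = p.2 then (1 : ℝ) else 0|}) := by
          refine measureReal_mono fun ω hω => ?_
          simp only [S, Set.mem_compl_iff, Set.mem_ofPred_eq, not_forall, not_le] at hω
          obtain ⟨i, j, hij⟩ := hω
          exact Set.mem_iUnion.2 ⟨(i, j), hij⟩
      _ ≤ ∑ _p : Fin k × Fin k, 2 / (n : ℝ) ^ 2 :=
          (measureReal_iUnion_fintype_le _).trans (Finset.sum_le_sum fun p _ => hpair p)
      _ = 2 * (k : ℝ) ^ 2 / (n : ℝ) ^ 2 := by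
          simp
          ring
  have hone : 1 ≤ P.real S + P.real Sᶜ := by
    simpa using measureReal_union_le (μ := P) S Sᶜ
  rw [ENNReal.ofReal_le_iff_le_toReal (measure_ne_top P S)]
  change _ ≤ P.real S
  linarith
end
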